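/- arXiv:1708.09012 — 3 statements merged into one kernel-verified Lean document; each statement's English description precedes it below -/
import Mathlib

section
/- Let Γ be a countable amenable group, and let Γ ↷ X and Γ ↷ Y be expansive continuous actions on compact metrizable spaces, both with the weak specification property, satisfying h_top(X) = h_top(Y). Then every pre-injective continuous Γ-equivariant map T: X → Y is surjective. -/
open Filter Topology MeasureTheory
open scoped symmDiff

namespace GOE

/-- The action of `Γ` on `X` is continuous (each group element acts continuously). -/
def ContAction (Γ X : Type*) [Group Γ] [TopologicalSpace X] [MulAction Γ X] : Prop :=
  ∀ s : Γ, Continuous fun x : X => s • x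

/-- The weak specification property with respect to the metric on `X`. -/
def WeakSpec (Γ X : Type*) [Group Γ] [MetricSpace X] [MulAction Γ X] : Prop :=
  ∀ ε : ℝ, 0 < ε → ∃ F : Finset Γ, F.Nonempty ∧ (∀ s ∈ F, s⁻¹ ∈ F) ∧
    ∀ (J : Type) (_ : Fintype J) (Fj : J → Finset Γ),
      (∀ i j : J, i ≠ j → ∀ f ∈ F, ∀ s ∈ Fj i, f * s ∉ Fj j) →
      ∀ xj : J → X, ∃ x : X, ∀ j : J, ∀ s ∈ Fj j, dist (s • x) (s • xj j) ≤ ε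

/-- Expansiveness of the action with respect to the metric on `X`. -/
def Expansive (Γ X : Type*) [Group Γ] [MetricSpace X] [MulAction Γ X] : Prop :=
  ∃ κ : ℝ, 0 < κ ∧ ∀ x y : X, x ≠ y → ∃ s : Γ, κ < dist (s • x) (s • y)

/-- `(x, y)` is a homoclinic pair: `dist (s • x) (s • y) → 0` as `s → ∞` in `Γ`. -/
def Homoclinic (Γ : Type*) {X : Type*} [Group Γ] [MetricSpace X] [MulAction Γ X]
    (x y : X) : Prop :=
  ∀ ε : ℝ, 0 < ε → ∃ E : Finset Γ, ∀ s : Γ, s ∉ E → dist (s • x) (s • y) < ε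

/-- `T` is pre-injective: injective on each homoclinic equivalence class. -/
def PreInjective (Γ : Type*) {X Y : Type*} [Group Γ] [MetricSpace X] [MulAction Γ X]
    (T : X → Y) : Prop :=
  ∀ x y : X, Homoclinic Γ x y → T x = T y → x = y

/-- `F` is a left Følner sequence for `Γ`. -/
def IsFolner (Γ : Type*) [Group Γ] (F : ℕ → Finset Γ) : Prop :=
  letI := Classical.decEq Γ
  (∀ n, (F n).Nonempty) ∧
  ∀ K : Finset Γ, K.Nonempty →
    Tendsto (fun n =>
        ((((K.biUnion fun k => (F n).image fun t => k * t) ∆ (F n)).card : ℝ) / (F n).card))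
      atTop (𝓝 0)

/-- The minimal number of members of the cover `⋁_{s ∈ E} s⁻¹ U` needed to cover `Z`. -/
noncomputable def covNumOn (Γ X : Type*) [Group Γ] [TopologicalSpace X] [MulAction Γ X]
    (Z : Set X) (U : Finset (Set X)) (E : Finset Γ) : ℕ :=
  sInf {n : ℕ | ∃ c : Finset (Γ → Set X), c.card = n ∧ (∀ f ∈ c, ∀ s : Γ, f s ∈ U) ∧
    Z ⊆ ⋃ f ∈ c, ⋂ s ∈ E, (fun x : X => s • x) ⁻¹' f s}

/-- Topological entropy of the restriction of the action to the invariant set `Z`,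
computed along the Følner sequence `F` via open covers. -/
noncomputable def topEntOn (Γ X : Type*) [Group Γ] [TopologicalSpace X] [MulAction Γ X]
    (Z : Set X) (F : ℕ → Finset Γ) : EReal :=
  ⨆ (U : Finset (Set X)) (_ : (∀ V ∈ U, IsOpen V) ∧ Z ⊆ ⋃₀ (↑U : Set (Set X))),
    Filter.limsup
      (fun n => ((Real.log (covNumOn Γ X Z U (F n)) / (F n).card : ℝ) : EReal)) Filter.atTop

/-- Maximal cardinality of a `(ρ_E, ε)`-separated subset of `Z`. -/
noncomputable def sepNum (Γ X : Type*) [Group Γ] [MetricSpace X] [MulAction Γ X]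
    (Z : Set X) (E : Finset Γ) (ε : ℝ) : ℕ :=
  sSup {n : ℕ | ∃ W : Finset X, (↑W : Set X) ⊆ Z ∧ W.card = n ∧
    ∀ x ∈ W, ∀ y ∈ W, x ≠ y → ∃ s ∈ E, ε ≤ dist (s • x) (s • y)}

/-- Minimal cardinality of a `(ρ_E, ε)`-spanning subset of `Z`. -/
noncomputable def spnNum (Γ X : Type*) [Group Γ] [MetricSpace X] [MulAction Γ X]
    (Z : Set X) (E : Finset Γ) (ε : ℝ) : ℕ :=
  sInf {n : ℕ | ∃ W : Finset X, (↑W : Set X) ⊆ Z ∧ W.card = n ∧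
    ∀ x ∈ Z, ∃ w ∈ W, ∀ s ∈ E, dist (s • x) (s • w) < ε}

/-- Shannon entropy of a finite family of Borel sets. -/
noncomputable def shannonH {X : Type*} [MeasurableSpace X] (μ : Measure X)
    (P : Finset (Set X)) : ℝ :=
  ∑ A ∈ P, -((μ A).toReal * Real.log (μ A).toReal)

/-- The join `⋁_{s ∈ E} s⁻¹ P` of the partition `P`. -/
noncomputable def joinPart (Γ X : Type*) [Group Γ] [MulAction Γ X]
    (P : Finset (Set X)) (E : Finset Γ) : Finset (Set X) :=
  letI := Classical.decEq Γ
  letI := Classical.decEq (Set X)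
  (E.pi fun _ => P).image fun f => ⋂ s, ⋂ (h : s ∈ E), (fun x : X => s • x) ⁻¹' f s h

/-- Dynamical entropy of the partition `P` along the Følner sequence `F`. -/
noncomputable def dynEnt (Γ X : Type*) [Group Γ] [MulAction Γ X] [MeasurableSpace X]
    (μ : Measure X) (P : Finset (Set X)) (F : ℕ → Finset Γ) : ℝ :=
  Filter.limsup (fun n => shannonH μ (joinPart Γ X P (F n)) / (F n).card) Filter.atTop

/-- `P` is a finite Borel partition of `X`. -/
def IsBorelPartition {X : Type*} [MeasurableSpace X] (P : Finset (Set X)) : Prop :=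
  (∀ A ∈ P, MeasurableSet A) ∧ (∀ A ∈ P, ∀ B ∈ P, A ≠ B → Disjoint A B) ∧
    ⋃₀ (↑P : Set (Set X)) = Set.univ

/-- Completely positive entropy of `Γ ↷ (X, μ)` along the Følner sequence `F`. -/
def HasCPE (Γ X : Type*) [Group Γ] [MulAction Γ X] [MeasurableSpace X]
    (μ : Measure X) (F : ℕ → Finset Γ) : Prop :=
  ∀ P : Finset (Set X), IsBorelPartition P → 0 < shannonH μ P → 0 < dynEnt Γ X μ P F

/-- `K'` is an independence set for the tuple `D` of subsets of `X`. -/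
def IsIndepSet (Γ X : Type*) [Group Γ] [MulAction Γ X] {k : ℕ}
    (D : Fin k → Set X) (K' : Finset Γ) : Prop :=
  ∀ ω : Γ → Fin k, ∃ x : X, ∀ s ∈ K', s • x ∈ D (ω s)

/-- The independence density of the tuple `D`. -/
noncomputable def indepDensity (Γ X : Type*) [Group Γ] [MulAction Γ X] {k : ℕ}
    (D : Fin k → Set X) : ℝ :=
  sInf {r : ℝ | ∃ K : Finset Γ, K.Nonempty ∧
    r = ((sSup {n : ℕ | ∃ K' ⊆ K, K'.card = n ∧ IsIndepSet Γ X D K'} : ℕ) : ℝ) / K.card}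

/-- The shift action `(s • x)_t = x_{s⁻¹ t}` on `Γ → A`. -/
def shiftAct {Γ A : Type*} [Group Γ] (s : Γ) (x : Γ → A) : Γ → A := fun t => x (s⁻¹ * t)

end GOE

open GOE

section Helpers

universe u v

/-- There is a subcover of `⋁_{s ∈ E} s⁻¹ U` of `Z` with at most `n` members. -/
def HasCov (Γ X : Type*) [Group Γ] [MulAction Γ X]
    (Z : Set X) (U : Finset (Set X)) (E : Finset Γ) (n : ℕ) : Prop :=
  ∃ c : Finset (Γ → Set X), c.card ≤ n ∧ (∀ f ∈ c, ∀ s : Γ, f s ∈ U) ∧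
    Z ⊆ ⋃ f ∈ c, ⋂ s ∈ E, (fun x : X => s • x) ⁻¹' f s

/-- `W` is a `δ`-separated subset of `Z` at times in `E`. -/
def IsSepSet (Γ X : Type*) [Group Γ] [MetricSpace X] [MulAction Γ X]
    (Z : Set X) (E : Finset Γ) (δ : ℝ) (W : Finset X) : Prop :=
  (∀ w ∈ W, w ∈ Z) ∧ ∀ x ∈ W, ∀ y ∈ W, x ≠ y → ∃ s ∈ E, δ ≤ dist (s • x) (s • y)

theorem covNumOn_le_of_hasCov {Γ X : Type*} [Group Γ] [TopologicalSpace X] [MulAction Γ X]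
    {Z : Set X} {U : Finset (Set X)} {E : Finset Γ} {n : ℕ} (h : HasCov Γ X Z U E n) :
    covNumOn Γ X Z U E ≤ n := by
  obtain ⟨c, hc, h1, h2⟩ := h
  exact le_trans (Nat.sInf_le ⟨c, rfl, h1, h2⟩) hc

theorem HasCov.insert_step {Γ X : Type*} [Group Γ] [MulAction Γ X]
    {Z : Set X} {U : Finset (Set X)}
    (hU : Set.univ ⊆ ⋃₀ (↑U : Set (Set X)))
    [DecidableEq Γ] {E E' : Finset Γ} {n : ℕ} (h : HasCov Γ X Z U E n) :
    HasCov Γ X Z U (E ∪ E') (n * U.card ^ E'.card) := by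
  classical
  induction E' using Finset.induction_on with
  | empty => simpa using h
  | insert s E' hs ih =>
    obtain ⟨c, hc, h1, h2⟩ := ih
    refine ⟨Finset.image₂ (fun f V => Function.update f s V) c U, ?_, ?_, ?_⟩
    · refine (Finset.card_image₂_le _ _ _).trans ?_
      rw [Finset.card_insert_of_notMem hs, pow_succ, ← mul_assoc]
      exact Nat.mul_le_mul_right _ hc
    · intro f hf t
      obtain ⟨g, hg, V, hV, rfl⟩ := Finset.mem_image₂.1 hf
      by_cases hts : t = s
      · subst hts; simpa using hV
      · simpa [Function.update_of_ne hts] using h1 g hg t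
    · intro x hx
      have hx2 := h2 hx
      simp only [Set.mem_iUnion, Set.mem_iInter, Set.mem_preimage] at hx2 ⊢
      obtain ⟨g, hg, hgx⟩ := hx2
      obtain ⟨V, hV, hxV⟩ := hU (Set.mem_univ (s • x))
      refine ⟨_, Finset.mem_image₂_of_mem hg hV, ?_⟩
      intro t ht
      by_cases hts : t = s
      · subst hts; simpa using hxV
      · rw [Function.update_of_ne hts]
        apply hgx
        simp only [Finset.mem_union, Finset.mem_insert] at ht ⊢
        tauto

theorem HasCov.mono {Γ X : Type*} [Group Γ] [MulAction Γ X]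
    {Z : Set X} {U : Finset (Set X)} {E E' : Finset Γ} {n m : ℕ} (h : HasCov Γ X Z U E n)
    (hE : E' ⊆ E) (hn : n ≤ m) : HasCov Γ X Z U E' m := by
  obtain ⟨c, hc, h1, h2⟩ := h
  refine ⟨c, hc.trans hn, h1, fun x hx => ?_⟩
  have hx2 := h2 hx
  simp only [Set.mem_iUnion, Set.mem_iInter, Set.mem_preimage] at hx2 ⊢
  obtain ⟨g, hg, hgx⟩ := hx2
  exact ⟨g, hg, fun s hs => hgx s (hE hs)⟩

theorem hasCov_empty {Γ X : Type*} [Group Γ] [MulAction Γ X]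
    {Z : Set X} {U : Finset (Set X)} (hZ : Z.Nonempty)
    (hU : Set.univ ⊆ ⋃₀ (↑U : Set (Set X))) :
    HasCov Γ X Z U ∅ 1 := by
  obtain ⟨z, hz⟩ := hZ
  obtain ⟨V, hV, -⟩ := hU (Set.mem_univ z)
  exact ⟨{fun _ => V}, by simp, by simpa using hV, by simp⟩

theorem hasCov_card {Γ X : Type*} [Group Γ] [MulAction Γ X]
    {Z : Set X} {U : Finset (Set X)} (hZ : Z.Nonempty)
    (hU : Set.univ ⊆ ⋃₀ (↑U : Set (Set X))) (E : Finset Γ) :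
    HasCov Γ X Z U E (U.card ^ E.card) := by
  classical
  have := (hasCov_empty (Γ := Γ) hZ hU).insert_step hU (E' := E)
  simpa using this

theorem hasCov_covNumOn {Γ X : Type*} [Group Γ] [TopologicalSpace X] [MulAction Γ X]
    {Z : Set X} {U : Finset (Set X)} (hZ : Z.Nonempty)
    (hU : Set.univ ⊆ ⋃₀ (↑U : Set (Set X))) (E : Finset Γ) :
    HasCov Γ X Z U E (covNumOn Γ X Z U E) := by
  obtain ⟨c, hc, h1, h2⟩ := hasCov_card (Γ := Γ) hZ hU E
  have := Nat.sInf_mem (s := {n : ℕ | ∃ c : Finset (Γ → Set X), c.card = n ∧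
    (∀ f ∈ c, ∀ s : Γ, f s ∈ U) ∧
    Z ⊆ ⋃ f ∈ c, ⋂ s ∈ E, (fun x : X => s • x) ⁻¹' f s}) ⟨_, c, rfl, h1, h2⟩
  obtain ⟨c, hc, h1, h2⟩ := this
  exact ⟨c, hc.le, h1, h2⟩

theorem covNumOn_pos {Γ X : Type*} [Group Γ] [TopologicalSpace X] [MulAction Γ X]
    {Z : Set X} {U : Finset (Set X)} (hZ : Z.Nonempty)
    (hU : Set.univ ⊆ ⋃₀ (↑U : Set (Set X))) (E : Finset Γ) :
    0 < covNumOn Γ X Z U E := by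
  obtain ⟨c, hc, h1, h2⟩ := hasCov_covNumOn (Γ := Γ) hZ hU E
  obtain ⟨z, hz⟩ := hZ
  have hx2 := h2 hz
  simp only [Set.mem_iUnion] at hx2
  obtain ⟨g, hg, -⟩ := hx2
  exact (Finset.card_pos.2 ⟨g, hg⟩).trans_le hc

theorem covNumOn_union_le {Γ X : Type*} [Group Γ] [TopologicalSpace X] [MulAction Γ X]
    {Z : Set X} {U : Finset (Set X)} (hZ : Z.Nonempty)
    (hU : Set.univ ⊆ ⋃₀ (↑U : Set (Set X))) [DecidableEq Γ] {E E' S : Finset Γ}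
    (hS : S ⊆ E ∪ E') :
    covNumOn Γ X Z U S ≤ covNumOn Γ X Z U E * U.card ^ E'.card :=
  covNumOn_le_of_hasCov (((hasCov_covNumOn hZ hU E).insert_step hU).mono hS le_rfl)

theorem exists_small_cover (X : Type*) [MetricSpace X] [CompactSpace X] {δ : ℝ} (hδ : 0 < δ) :
    ∃ U : Finset (Set X), (∀ V ∈ U, IsOpen V) ∧ Set.univ ⊆ ⋃₀ (↑U : Set (Set X)) ∧
      ∀ V ∈ U, ∀ x ∈ V, ∀ y ∈ V, dist x y < δ := by
  classical
  obtain ⟨t, ht⟩ := isCompact_univ.elim_finite_subcover (fun x : X => Metric.ball x (δ / 2))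
    (fun x => Metric.isOpen_ball)
    (fun x _ => Set.mem_iUnion.2 ⟨x, Metric.mem_ball_self (by positivity)⟩)
  refine ⟨t.image fun x => Metric.ball x (δ / 2), ?_, ?_, ?_⟩
  · intro V hV
    obtain ⟨x, -, rfl⟩ := Finset.mem_image.1 hV
    exact Metric.isOpen_ball
  · intro x hx
    have := ht hx
    simp only [Set.mem_iUnion] at this
    obtain ⟨y, hy, hxy⟩ := this
    exact ⟨_, by simpa using ⟨y, hy, rfl⟩, hxy⟩
  · intro V hV x hx y hy
    obtain ⟨z, -, rfl⟩ := Finset.mem_image.1 hV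
    rw [Metric.mem_ball] at hx hy
    have := dist_triangle_right x y z
    linarith

theorem sep_card_le_cov {Γ X : Type*} [Group Γ] [MetricSpace X] [MulAction Γ X]
    {Z : Set X} {U : Finset (Set X)} (hZ : Z.Nonempty)
    (hU : Set.univ ⊆ ⋃₀ (↑U : Set (Set X))) {E : Finset Γ} {δ : ℝ}
    (hd : ∀ V ∈ U, ∀ x ∈ V, ∀ y ∈ V, dist x y < δ) {W : Finset X}
    (hW : IsSepSet Γ X Z E δ W) : W.card ≤ covNumOn Γ X Z U E := by
  obtain ⟨c, hc, h1, h2⟩ := hasCov_covNumOn (Γ := Γ) hZ hU E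
  refine le_trans ?_ hc
  have key : ∀ w ∈ W, ∃ f ∈ c, ∀ s ∈ E, s • w ∈ f s := by
    intro w hw
    have hx2 := h2 (hW.1 w hw)
    simpa only [Set.mem_iUnion, Set.mem_iInter, Set.mem_preimage, exists_prop] using hx2
  choose! g hgc hg using key
  refine Finset.card_le_card_of_injOn g hgc ?_
  intro x hx y hy hxy
  by_contra hne
  obtain ⟨s, hs, hsd⟩ := hW.2 x hx y hy hne
  have := hd _ (h1 _ (hgc x hx) s) _ (hg x hx s hs) _ (hxy ▸ hg y hy s hs)
  linarith

theorem exists_sep_cov_le {Γ X : Type*} [Group Γ] [MetricSpace X] [CompactSpace X]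
    [MulAction Γ X] {Z : Set X} (hZ : Z.Nonempty) {U : Finset (Set X)}
    (hUo : ∀ V ∈ U, IsOpen V) (hU : Set.univ ⊆ ⋃₀ (↑U : Set (Set X))) :
    ∃ δ : ℝ, 0 < δ ∧ ∀ E : Finset Γ, ∃ W : Finset X, IsSepSet Γ X Z E δ W ∧
      covNumOn Γ X Z U E ≤ W.card := by
  classical
  obtain ⟨δ, hδ, hleb⟩ := lebesgue_number_lemma_of_metric_sUnion isCompact_univ
    (c := (↑U : Set (Set X))) (fun V hV => hUo V hV) hU
  refine ⟨δ, hδ, fun E => ?_⟩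
  obtain ⟨U', -, hU', hd⟩ := exists_small_cover X hδ
  let S : Set ℕ := {n | ∃ W : Finset X, IsSepSet Γ X Z E δ W ∧ W.card = n}
  have hSne : S.Nonempty := ⟨0, ∅, ⟨by simp, by simp⟩, by simp⟩
  have hSb : BddAbove S := by
    refine ⟨covNumOn Γ X Z U' E, ?_⟩
    rintro n ⟨W, hW, rfl⟩
    exact sep_card_le_cov hZ hU' hd hW
  obtain ⟨W, hW, hWc⟩ := Nat.sSup_mem hSne hSb
  refine ⟨W, hW, ?_⟩
  have hspan : ∀ x ∈ Z, ∃ w ∈ W, ∀ s ∈ E, dist (s • x) (s • w) < δ := by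
    intro x hx
    by_contra hcon
    push Not at hcon
    have hxW : x ∉ W := fun hxW => by
      obtain ⟨s, -, hs⟩ := hcon x hxW
      simp at hs; linarith
    have : IsSepSet Γ X Z E δ (insert x W) := by
      refine ⟨?_, ?_⟩
      · intro w hw
        rcases Finset.mem_insert.1 hw with rfl | hw
        · exact hx
        · exact hW.1 w hw
      · intro a ha b hb hab
        rcases Finset.mem_insert.1 ha with ha1 | ha1 <;>
          rcases Finset.mem_insert.1 hb with hb1 | hb1
        · exact absurd (ha1.trans hb1.symm) hab
        · rw [ha1]; exact hcon b hb1
        · obtain ⟨s, hs, h⟩ := hcon a ha1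
          exact ⟨s, hs, by rwa [hb1, dist_comm]⟩
        · exact hW.2 a ha1 b hb1 hab
    have h1 : (insert x W).card ≤ sSup S := le_csSup hSb ⟨_, this, rfl⟩
    rw [Finset.card_insert_of_notMem hxW] at h1
    omega
  choose V hVU hV using fun x : X => hleb x (Set.mem_univ x)
  apply covNumOn_le_of_hasCov
  refine ⟨W.image fun w s => V (s • w), Finset.card_image_le, ?_, ?_⟩
  · intro f hf s
    obtain ⟨w, -, rfl⟩ := Finset.mem_image.1 hf
    exact hVU _
  · intro x hx
    obtain ⟨w, hw, h⟩ := hspan x hx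
    simp only [Set.mem_iUnion, Set.mem_iInter, Set.mem_preimage]
    exact ⟨_, Finset.mem_image_of_mem _ hw, fun s hs => hV _ (h s hs)⟩

/-- Weak specification for index types in any universe, with `1` in the finite set. -/
theorem weakSpec_general {Γ : Type u} {X : Type v} [Group Γ] [MetricSpace X] [MulAction Γ X]
    (h : WeakSpec Γ X) {ε : ℝ} (hε : 0 < ε) :
    ∃ K : Finset Γ, (1 : Γ) ∈ K ∧ (∀ s ∈ K, s⁻¹ ∈ K) ∧
    ∀ (J : Type u) (_ : Fintype J) (Fj : J → Finset Γ),
      (∀ i j : J, i ≠ j → ∀ f ∈ K, ∀ s ∈ Fj i, f * s ∉ Fj j) →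
      ∀ xj : J → X, ∃ x : X, ∀ j : J, ∀ s ∈ Fj j, dist (s • x) (s • xj j) ≤ ε := by
  classical
  obtain ⟨K, -, hK, hsp⟩ := h ε hε
  refine ⟨insert 1 K, by simp, ?_, ?_⟩
  · intro s hs
    rcases Finset.mem_insert.1 hs with rfl | hs
    · simp
    · exact Finset.mem_insert_of_mem (hK s hs)
  · intro J _ Fj hFj xj
    let e := Fintype.equivFin J
    obtain ⟨x, hx⟩ := hsp (Fin (Fintype.card J)) inferInstance (fun i => Fj (e.symm i))
      (fun i j hij f hf s hs => hFj _ _ (fun h => hij (e.symm.injective h)) f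
        (Finset.mem_insert_of_mem hf) s hs) (fun i => xj (e.symm i))
    refine ⟨x, fun j s hs => ?_⟩
    have := hx (e j) s (by simpa using hs)
    simpa using this

/-- Uniform form of expansiveness. -/
theorem expansive_uniform {Γ X : Type*} [Group Γ] [MetricSpace X] [CompactSpace X]
    [MulAction Γ X] (hact : ContAction Γ X) {κ : ℝ}
    (hκ : ∀ x y : X, x ≠ y → ∃ s : Γ, κ < dist (s • x) (s • y)) {ε : ℝ} (hε : 0 < ε) :
    ∃ L : Finset Γ, ∀ x y : X, (∀ s ∈ L, dist (s • x) (s • y) ≤ κ) → dist x y < ε := by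
  have hcpt : IsCompact {p : X × X | ε ≤ dist p.1 p.2} :=
    (isClosed_le continuous_const continuous_dist).isCompact
  obtain ⟨L, hL⟩ := hcpt.elim_finite_subcover
    (fun s : Γ => {p : X × X | κ < dist (s • p.1) (s • p.2)})
    (fun s => isOpen_lt continuous_const
      (((hact s).comp continuous_fst).dist ((hact s).comp continuous_snd)))
    (by
      rintro ⟨x, y⟩ hxy
      have hne : x ≠ y := by
        rintro rfl
        simp at hxy; linarith
      obtain ⟨s, hs⟩ := hκ x y hne
      exact Set.mem_iUnion.2 ⟨s, hs⟩)
  refine ⟨L, fun x y h => ?_⟩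
  by_contra hcon
  push Not at hcon
  have := hL (show (x, y) ∈ {p : X × X | ε ≤ dist p.1 p.2} from hcon)
  simp only [Set.mem_iUnion] at this
  obtain ⟨s, hs, hlt⟩ := this
  exact absurd (h s hs) (not_le.2 hlt)

theorem homoclinic_of_close {Γ X : Type*} [Group Γ] [MetricSpace X] [CompactSpace X]
    [MulAction Γ X] (hact : ContAction Γ X) {κ : ℝ}
    (hκ : ∀ x y : X, x ≠ y → ∃ s : Γ, κ < dist (s • x) (s • y)) {E : Finset Γ} {x y : X}
    (h : ∀ s ∉ E, dist (s • x) (s • y) ≤ κ) : Homoclinic Γ x y := by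
  classical
  intro ε hε
  obtain ⟨L, hL⟩ := expansive_uniform hact hκ hε
  refine ⟨Finset.image₂ (fun l e => l⁻¹ * e) L E, fun s hs => hL _ _ fun l hl => ?_⟩
  rw [smul_smul, smul_smul]
  refine h _ fun hE => hs ?_
  exact Finset.mem_image₂.2 ⟨l, hl, l * s, hE, by group⟩

/-- Gluing a point on `E` with `x₀` outside `K E`. -/
theorem glue {Γ X : Type*} [Group Γ] [MetricSpace X] [CompactSpace X]
    [MulAction Γ X] (hact : ContAction Γ X) (h : WeakSpec Γ X) {ε : ℝ} (hε : 0 < ε) :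
    ∃ K : Finset Γ, K.Nonempty ∧ ∀ (E E' : Finset Γ), (∀ k ∈ K, ∀ t ∈ E, k * t ∈ E') →
      ∀ w x₀ : X, ∃ x : X,
        (∀ s ∈ E, dist (s • x) (s • w) ≤ ε) ∧ (∀ s ∉ E', dist (s • x) (s • x₀) ≤ ε) := by
  classical
  obtain ⟨K, hK1, hKs, hsp⟩ := weakSpec_general h hε
  refine ⟨K, ⟨1, hK1⟩, fun E E' hE w x₀ => ?_⟩
  let C : Finset Γ → Set X := fun S =>
    (⋂ s ∈ E, {x : X | dist (s • x) (s • w) ≤ ε}) ∩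
      ⋂ s ∈ S \ E', {x : X | dist (s • x) (s • x₀) ≤ ε}
  have hclosed : ∀ S, IsClosed (C S) := fun S =>
    (isClosed_biInter fun s _ => isClosed_le ((hact s).dist continuous_const)
      continuous_const).inter (isClosed_biInter fun s _ =>
        isClosed_le ((hact s).dist continuous_const) continuous_const)
  have hne : ∀ S, (C S).Nonempty := by
    intro S
    obtain ⟨x, hx⟩ := hsp (ULift Bool) inferInstance (fun b => if b.down then E else S \ E')
      (by
        rintro ⟨i⟩ ⟨j⟩ hij f hf s hs hfs
        cases i <;> cases j
        · exact hij rfl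
        · simp only [Bool.false_eq_true, if_false, if_true, Finset.mem_sdiff] at hs hfs
          apply hs.2
          have := hE _ (hKs f hf) _ hfs
          simpa using this
        · simp only [Bool.false_eq_true, if_false, if_true, Finset.mem_sdiff] at hs hfs
          exact hfs.2 (hE f hf s hs)
        · exact hij rfl)
      (fun b => if b.down then w else x₀)
    refine ⟨x, ?_, ?_⟩
    · have := hx ⟨true⟩
      simpa [Set.mem_iInter] using this
    · have := hx ⟨false⟩
      simpa [Set.mem_iInter] using this
  have hdir : Directed (· ⊇ ·) C := by
    intro S S'
    refine ⟨S ∪ S', ?_, ?_⟩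
    · rintro x ⟨h1, h2⟩
      refine ⟨h1, ?_⟩
      simp only [Set.mem_iInter, Finset.mem_sdiff, Finset.mem_union] at h2 ⊢
      exact fun s hs => h2 s ⟨Or.inl hs.1, hs.2⟩
    · rintro x ⟨h1, h2⟩
      refine ⟨h1, ?_⟩
      simp only [Set.mem_iInter, Finset.mem_sdiff, Finset.mem_union] at h2 ⊢
      exact fun s hs => h2 s ⟨Or.inr hs.1, hs.2⟩
  obtain ⟨x, hx⟩ := IsCompact.nonempty_iInter_of_directed_nonempty_isCompact_isClosed C hdir hne
    (fun S => (hclosed S).isCompact) hclosed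
  rw [Set.mem_iInter] at hx
  refine ⟨x, ?_, ?_⟩
  · have := (hx ∅).1
    simpa [Set.mem_iInter] using this
  · intro s hs
    have := (hx {s}).2
    simp only [Set.mem_iInter, Finset.mem_sdiff, Finset.mem_singleton] at this
    exact this s ⟨rfl, hs⟩

/-- Part 1: covering numbers of `X` are controlled by those of the image. -/
theorem part_one {Γ X Y : Type*} [Group Γ]
    [MetricSpace X] [CompactSpace X] [MulAction Γ X]
    [MetricSpace Y] [CompactSpace Y] [MulAction Γ Y]
    (hactX : ContAction Γ X) (hexpX : Expansive Γ X) (hwsX : WeakSpec Γ X) [Nonempty X]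
    {κ : ℝ} (hκ0 : 0 < κ) (hκ : ∀ x y : Y, x ≠ y → ∃ s : Γ, κ < dist (s • x) (s • y))
    (T : X → Y) (hTc : Continuous T)
    (hTequiv : ∀ (s : Γ) (x : X), T (s • x) = s • T x)
    (hTpre : PreInjective Γ T)
    {V : Finset (Set Y)} (hV : Set.univ ⊆ ⋃₀ (↑V : Set (Set Y)))
    (hVd : ∀ A ∈ V, ∀ x ∈ A, ∀ y ∈ A, dist x y < κ)
    {U : Finset (Set X)} (hUo : ∀ A ∈ U, IsOpen A) (hU : Set.univ ⊆ ⋃₀ (↑U : Set (Set X))) :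
    ∃ K : Finset Γ, K.Nonempty ∧ ∀ (E E' : Finset Γ), (∀ k ∈ K, ∀ t ∈ E, k * t ∈ E') →
      covNumOn Γ X Set.univ U E ≤ covNumOn Γ Y (Set.range T) V E' := by
  classical
  obtain ⟨κX, hκX0, hκX⟩ := hexpX
  obtain ⟨δ, hδ, hsep⟩ := exists_sep_cov_le (Γ := Γ) Set.univ_nonempty hUo hU
  obtain ⟨η, hη, hTη⟩ := Metric.uniformContinuous_iff.1
    (CompactSpace.uniformContinuous_of_continuous hTc) κ hκ0
  let ε := min (δ / 4) (min (κX / 4) (η / 4))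
  have hε : 0 < ε := by positivity
  have h1 : ε ≤ δ / 4 := min_le_left _ _
  have h2 : ε ≤ κX / 4 := (min_le_right _ _).trans (min_le_left _ _)
  have h3 : ε ≤ η / 4 := (min_le_right _ _).trans (min_le_right _ _)
  obtain ⟨K, hK, hglue⟩ := glue hactX hwsX hε
  refine ⟨K, hK, fun E E' hE => ?_⟩
  obtain ⟨W, hW, hWc⟩ := hsep E
  refine hWc.trans ?_
  obtain ⟨x₀⟩ := ‹Nonempty X›
  choose g hg1 hg2 using fun w => hglue E E' hE w x₀
  have hclose : ∀ w v, ∀ s ∉ E', dist (s • g w) (s • g v) ≤ 2 * ε := by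
    intro w v s hs
    have a := hg2 w s hs
    have b := hg2 v s hs
    have := dist_triangle_right (s • g w) (s • g v) (s • x₀)
    linarith
  have hginj : ∀ w ∈ W, ∀ v ∈ W, g w = g v → w = v := by
    intro w hw v hv hgv
    by_contra hne
    obtain ⟨s, hs, hd⟩ := hW.2 w hw v hv hne
    have a := hg1 w s hs
    have b := hg1 v s hs
    rw [hgv] at a
    have := dist_triangle_left (s • w) (s • v) (s • g v)
    linarith
  have hTinj : ∀ w v, T (g w) = T (g v) → g w = g v := by
    intro w v h
    refine hTpre _ _ (homoclinic_of_close hactX hκX (E := E') fun s hs => ?_) h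
    have := hclose w v s hs
    linarith
  have hcard : (W.image fun w => T (g w)).card = W.card :=
    Finset.card_image_of_injOn fun w hw v hv h => hginj w hw v hv (hTinj _ _ h)
  rw [← hcard]
  refine sep_card_le_cov (Set.range_nonempty T) hV hVd ⟨?_, ?_⟩
  · intro y hy
    obtain ⟨w, -, rfl⟩ := Finset.mem_image.1 hy
    exact ⟨_, rfl⟩
  · intro a ha b hb hab
    obtain ⟨w, -, rfl⟩ := Finset.mem_image.1 ha
    obtain ⟨v, -, rfl⟩ := Finset.mem_image.1 hb
    obtain ⟨s, hs⟩ := hκ _ _ hab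
    refine ⟨s, ?_, hs.le⟩
    by_contra hsE
    have := hclose w v s hsE
    have h4 : dist (T (s • g w)) (T (s • g v)) < κ := hTη (by linarith)
    rw [hTequiv, hTequiv] at h4
    linarith

theorem exists_max_separated {Γ : Type*} [Group Γ] (K : Finset Γ) (hK1 : (1 : Γ) ∈ K)
    (hKs : ∀ s ∈ K, s⁻¹ ∈ K) (E : Finset Γ) :
    ∃ A ⊆ E, (∀ s ∈ A, ∀ t ∈ A, s ≠ t → ∀ k ∈ K, k * s ≠ t) ∧ E.card ≤ K.card * A.card := by
  classical
  let P := E.powerset.filter fun A => ∀ s ∈ A, ∀ t ∈ A, s ≠ t → ∀ k ∈ K, k * s ≠ t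
  obtain ⟨A, hA, hmax⟩ := P.exists_max_image Finset.card ⟨∅, by simp [P]⟩
  simp only [P, Finset.mem_filter, Finset.mem_powerset] at hA hmax
  refine ⟨A, hA.1, hA.2, ?_⟩
  rw [← Finset.card_product]
  have : E ⊆ (K ×ˢ A).image fun p => p.1 * p.2 := by
    intro t ht
    by_contra hcon
    have hno : ∀ k ∈ K, ∀ s ∈ A, k * s ≠ t := fun k hk s hs h =>
      hcon (Finset.mem_image.2 ⟨(k, s), Finset.mem_product.2 ⟨hk, hs⟩, h⟩)
    have htA : t ∉ A := fun h => hno 1 hK1 t h (one_mul t)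
    have := hmax (insert t A) ⟨Finset.insert_subset ht hA.1, by
      intro a ha b hb hab k hk hkab
      rcases Finset.mem_insert.1 ha with ha1 | ha1 <;>
        rcases Finset.mem_insert.1 hb with hb1 | hb1
      · exact hab (ha1.trans hb1.symm)
      · exact hno _ (hKs k hk) b hb1 (by rw [← hkab, ha1]; group)
      · exact hno k hk a ha1 (hkab.trans hb1)
      · exact hA.2 a ha1 b hb1 hab k hk hkab⟩
    rw [Finset.card_insert_of_notMem htA] at this
    omega
  exact (Finset.card_le_card this).trans Finset.card_image_le

/-- Part 2: a proper closed invariant subset has exponentially smaller covering numbers. -/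
theorem part_two {Γ Y : Type*} [Group Γ]
    [MetricSpace Y] [CompactSpace Y] [MulAction Γ Y] (hws : WeakSpec Γ Y)
    {Z : Set Y} (hZc : IsClosed Z) (hZne : Z.Nonempty) (hZinv : ∀ (s : Γ), ∀ z ∈ Z, s • z ∈ Z)
    (hZ : Z ≠ Set.univ)
    {V : Finset (Set Y)} (hVo : ∀ A ∈ V, IsOpen A) (hV : Set.univ ⊆ ⋃₀ (↑V : Set (Set Y))) :
    ∃ c : ℝ, 0 < c ∧ ∃ V' : Finset (Set Y), (∀ A ∈ V', IsOpen A) ∧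
      Set.univ ⊆ ⋃₀ (↑V' : Set (Set Y)) ∧ ∀ E : Finset Γ,
        Real.log (covNumOn Γ Y Z V E) + c * E.card ≤
          Real.log (covNumOn Γ Y Set.univ V' E) := by
  classical
  obtain ⟨y₀, hy₀⟩ := (Set.ne_univ_iff_exists_notMem Z).1 hZ
  obtain ⟨η, hη, hball⟩ := Metric.isOpen_iff.1 hZc.isOpen_compl y₀ hy₀
  have hfar : ∀ z ∈ Z, η ≤ dist z y₀ := by
    intro z hz
    by_contra hcon
    push Not at hcon
    exact hball hcon hz
  obtain ⟨τ, hτ, hsep⟩ := exists_sep_cov_le (Γ := Γ) hZne hVo hV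
  let θ := min η τ
  have hθ : 0 < θ := by positivity
  have hθη : θ ≤ η := min_le_left _ _
  have hθτ : θ ≤ τ := min_le_right _ _
  obtain ⟨K, hK1, hKs, hsp⟩ := weakSpec_general hws (ε := θ / 4) (by positivity)
  obtain ⟨V', hVo', hV', hd'⟩ := exists_small_cover Y (δ := θ / 2) (by positivity)
  have hKpos : 0 < K.card := Finset.card_pos.2 ⟨1, hK1⟩
  have hVpos : 0 < V.card := by
    obtain ⟨A, hA, -⟩ := hV (Set.mem_univ y₀)
    exact Finset.card_pos.2 ⟨A, hA⟩
  let C : ℝ := (V.card : ℝ) ^ K.card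
  have hC : 0 < C := by positivity
  have hlog : 0 < Real.log (1 + C⁻¹) := Real.log_pos (by
    have : 0 < C⁻¹ := by positivity
    linarith)
  refine ⟨Real.log (1 + C⁻¹) / K.card, by positivity, V', hVo', hV', fun E => ?_⟩
  obtain ⟨A, hAE, hAsep, hAcard⟩ := exists_max_separated K hK1 hKs E
  let KB : Finset Γ → Finset Γ := fun B => (K ×ˢ B).image fun p => p.1 * p.2
  have hKB : ∀ B t, t ∈ KB B ↔ ∃ k ∈ K, ∃ s ∈ B, k * s = t := by
    intro B t
    simp only [KB, Finset.mem_image, Finset.mem_product, Prod.exists]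
    constructor
    · rintro ⟨k, s, ⟨hk, hs⟩, h⟩; exact ⟨k, hk, s, hs, h⟩
    · rintro ⟨k, hk, s, hs, h⟩; exact ⟨k, s, ⟨hk, hs⟩, h⟩
  choose W hW hWc using fun B : Finset Γ => hsep (E \ KB B)
  -- gluing
  have hgl : ∀ B : Finset Γ, ∀ w : Y, ∃ y : Y, B ⊆ A →
      (∀ s ∈ B, dist (s • y) y₀ ≤ θ / 4) ∧
      (∀ s ∈ E \ KB B, dist (s • y) (s • w) ≤ θ / 4) := by
    intro B w
    by_cases hB : B ⊆ A
    swap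
    · exact ⟨w, fun h => absurd h hB⟩
    obtain ⟨y, hy⟩ := hsp (Option B) inferInstance
      (fun j => j.elim (E \ KB B) (fun s => {s.1}))
      (by
        intro i j hij f hf s hs hfs
        rcases i with _ | i <;> rcases j with _ | j
        · exact hij rfl
        · simp only [Option.elim, Finset.mem_sdiff, Finset.mem_singleton] at hs hfs
          exact hs.2 ((hKB _ _).2 ⟨f⁻¹, hKs f hf, j.1, j.2, by rw [← hfs]; group⟩)
        · simp only [Option.elim, Finset.mem_sdiff, Finset.mem_singleton] at hs hfs
          exact hfs.2 ((hKB _ _).2 ⟨f, hf, i.1, i.2, by rw [hs]⟩)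
        · simp only [Option.elim, Finset.mem_singleton] at hs hfs
          refine hAsep i.1 (hB i.2) j.1 (hB j.2) (fun h => hij ?_) f hf (by rw [← hs, hfs])
          rw [Subtype.ext h])
      (fun j => j.elim w (fun s => s.1⁻¹ • y₀))
    refine ⟨y, fun _ => ⟨fun s hs => ?_, fun s hs => ?_⟩⟩
    · have := hy (some ⟨s, hs⟩) s (by simp)
      simpa using this
    · exact hy none s hs
  choose g hg using hgl
  let SS := A.powerset.sigma W
  have hmemS : ∀ p : (Σ _ : Finset Γ, Y), p ∈ SS ↔ p.1 ⊆ A ∧ p.2 ∈ W p.1 := by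
    intro p; simp [SS, Finset.mem_sigma]
  have hdiffB : ∀ p ∈ SS, ∀ q ∈ SS, ¬ p.1 ⊆ q.1 →
      ∃ s ∈ E, θ / 2 ≤ dist (s • g p.1 p.2) (s • g q.1 q.2) := by
    intro p hp q hq hpq
    rw [hmemS] at hp hq
    obtain ⟨s, hsp', hsq⟩ := Finset.not_subset.1 hpq
    have hsA := hp.1 hsp'
    refine ⟨s, hAE hsA, ?_⟩
    have a := (hg p.1 p.2 hp.1).1 s hsp'
    have hsE : s ∈ E \ KB q.1 := by
      refine Finset.mem_sdiff.2 ⟨hAE hsA, fun h => ?_⟩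
      obtain ⟨k, hk, t, ht, hkt⟩ := (hKB _ _).1 h
      refine hAsep t (hq.1 ht) s hsA (fun h => hsq (h ▸ ht)) k hk hkt
    have b := (hg q.1 q.2 hq.1).2 s hsE
    have c := hfar _ (hZinv s _ ((hW q.1).1 _ hq.2))
    have d1 := dist_triangle_left (s • q.2) y₀ (s • g q.1 q.2)
    have d2 := dist_triangle_left (s • g q.1 q.2) y₀ (s • g p.1 p.2)
    linarith
  have hsepS : ∀ p ∈ SS, ∀ q ∈ SS, p ≠ q →
      ∃ s ∈ E, θ / 2 ≤ dist (s • g p.1 p.2) (s • g q.1 q.2) := by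
    intro p hp q hq hpq
    by_cases h1 : p.1 ⊆ q.1
    swap
    · exact hdiffB p hp q hq h1
    by_cases h2 : q.1 ⊆ p.1
    swap
    · obtain ⟨s, hs, h⟩ := hdiffB q hq p hp h2
      exact ⟨s, hs, by rwa [dist_comm]⟩
    obtain ⟨B, w⟩ := p
    obtain ⟨B', v⟩ := q
    obtain rfl : B = B' := Finset.Subset.antisymm h1 h2
    rw [hmemS] at hp hq
    have hne : w ≠ v := fun h => hpq (by rw [h])
    obtain ⟨s, hs, hd⟩ := (hW B).2 w hp.2 v hq.2 hne
    refine ⟨s, (Finset.mem_sdiff.1 hs).1, ?_⟩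
    have a := (hg B w hp.1).2 s hs
    have b := (hg B v hq.1).2 s hs
    have d1 := dist_triangle_left (s • w) (s • v) (s • g B w)
    have d2 := dist_triangle (s • g B w) (s • g B v) (s • v)
    dsimp only
    linarith
  have hcount : SS.card ≤ covNumOn Γ Y Set.univ V' E := by
    have hinj : (SS.image fun p => g p.1 p.2).card = SS.card := by
      refine Finset.card_image_of_injOn fun p hp q hq h => ?_
      by_contra hne
      obtain ⟨s, -, hs⟩ := hsepS p hp q hq hne
      rw [h, dist_self] at hs
      linarith
    rw [← hinj]
    refine sep_card_le_cov ⟨y₀, Set.mem_univ _⟩ hV' hd' ⟨fun _ _ => Set.mem_univ _, ?_⟩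
    intro a ha b hb hab
    obtain ⟨p, hp, rfl⟩ := Finset.mem_image.1 ha
    obtain ⟨q, hq, rfl⟩ := Finset.mem_image.1 hb
    exact hsepS p hp q hq (fun h => hab (by rw [h]))
  set N := covNumOn Γ Y Z V E with hN
  have hNpos : 0 < N := covNumOn_pos hZne hV E
  have hNB : ∀ B : Finset Γ, (N : ℝ) * C⁻¹ ^ B.card ≤ (W B).card := by
    intro B
    have h1 : N ≤ covNumOn Γ Y Z V (E \ KB B) * V.card ^ (KB B).card :=
      covNumOn_union_le hZne hV (by
        intro s hs
        simp only [Finset.mem_union, Finset.mem_sdiff]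
        tauto)
    have h2 : (KB B).card ≤ K.card * B.card := by
      rw [← Finset.card_product]; exact Finset.card_image_le
    have h3 : N ≤ (W B).card * V.card ^ (K.card * B.card) :=
      h1.trans (Nat.mul_le_mul (hWc B) (Nat.pow_le_pow_right hVpos h2))
    have h4 : (N : ℝ) ≤ (W B).card * C ^ B.card := by
      have : (N : ℝ) ≤ ((W B).card * V.card ^ (K.card * B.card) : ℕ) := by exact_mod_cast h3
      simpa [C, pow_mul] using this
    rw [inv_pow, ← div_eq_mul_inv, div_le_iff₀ (by positivity)]
    exact h4
  have hmain : (N : ℝ) * (1 + C⁻¹) ^ A.card ≤ covNumOn Γ Y Set.univ V' E := by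
    have h1 : ((SS.card : ℕ) : ℝ) ≤ covNumOn Γ Y Set.univ V' E := by exact_mod_cast hcount
    refine le_trans ?_ h1
    have h2 : (1 + C⁻¹) ^ A.card = ∑ B ∈ A.powerset, C⁻¹ ^ B.card := by
      have := Finset.sum_pow_mul_eq_add_pow C⁻¹ (1 : ℝ) A
      rw [add_comm, ← this]
      simp
    rw [h2, Finset.mul_sum, Finset.card_sigma, Nat.cast_sum]
    exact Finset.sum_le_sum fun B _ => hNB B
  have hN0 : (0 : ℝ) < N := by exact_mod_cast hNpos
  have hpos : (0 : ℝ) < 1 + C⁻¹ := by positivity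
  have := Real.log_le_log (by positivity) hmain
  rw [Real.log_mul hN0.ne' (by positivity), Real.log_pow] at this
  refine le_trans ?_ this
  have hA' : (E.card : ℝ) ≤ K.card * A.card := by exact_mod_cast hAcard
  have hK0 : (0 : ℝ) < K.card := by exact_mod_cast hKpos
  have : Real.log (1 + C⁻¹) / K.card * E.card ≤ A.card * Real.log (1 + C⁻¹) := by
    rw [div_mul_eq_mul_div, div_le_iff₀ hK0]
    nlinarith
  linarith

end Helpers

/-- between expansive weak-specification systems of equal entropy,
pre-injective equivariant continuous maps are surjective. -/
theorem preInjective_implies_surjective_equal_entropy {Γ X Y : Type*} [Group Γ] [Countable Γ]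
    [MetricSpace X] [CompactSpace X] [MulAction Γ X]
    [MetricSpace Y] [CompactSpace Y] [MulAction Γ Y]
    (hactX : ContAction Γ X) (hactY : ContAction Γ Y)
    (F : ℕ → Finset Γ) (hF : IsFolner Γ F)
    (hexpX : Expansive Γ X) (hwsX : WeakSpec Γ X)
    (hexpY : Expansive Γ Y) (hwsY : WeakSpec Γ Y)
    (hent : topEntOn Γ X Set.univ F = topEntOn Γ Y Set.univ F)
    (T : X → Y) (hTc : Continuous T)
    (hTequiv : ∀ (s : Γ) (x : X), T (s • x) = s • T x)
    (hTpre : PreInjective Γ T) :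
    Function.Surjective T := by
  classical
  obtain ⟨x₀, -⟩ := (weakSpec_general hwsX one_pos).choose_spec.2.2 PEmpty inferInstance
    (fun i => i.elim) (fun i => i.elim) (fun i => i.elim)
  haveI : Nonempty X := ⟨x₀⟩
  by_contra hsurj
  have hZ : Set.range T ≠ Set.univ := fun h => hsurj (Set.range_eq_univ.1 h)
  obtain ⟨κ, hκ0, hκ⟩ := hexpY
  obtain ⟨V, hVo, hV, hVd⟩ := exists_small_cover Y hκ0
  obtain ⟨c, hc, V', hVo', hV', hV'E⟩ := part_two (Γ := Γ) hwsY (isCompact_range hTc).isClosed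
    (Set.range_nonempty T) (by rintro s _ ⟨x, rfl⟩; exact ⟨s • x, hTequiv s x⟩) hZ hVo hV
  have hFpos : ∀ n, (0 : ℝ) < (F n).card := fun n => by
    exact_mod_cast Finset.card_pos.2 (hF.1 n)
  have hYne : (Set.univ : Set Y).Nonempty := ⟨T x₀, trivial⟩
  let b : ℕ → ℝ := fun n => Real.log (covNumOn Γ Y Set.univ V' (F n)) / (F n).card
  have hb : ∀ n, b n ≤ Real.log V'.card := by
    intro n
    have h1 := covNumOn_le_of_hasCov (hasCov_card (Γ := Γ) hYne hV' (F n))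
    have h2 : (0 : ℝ) < covNumOn Γ Y Set.univ V' (F n) := by
      exact_mod_cast covNumOn_pos hYne hV' (F n)
    have h3 : (covNumOn Γ Y Set.univ V' (F n) : ℝ) ≤ (V'.card : ℝ) ^ (F n).card := by
      exact_mod_cast h1
    have h4 := Real.log_le_log h2 h3
    rw [Real.log_pow] at h4
    simp only [b]
    rw [div_le_iff₀ (hFpos n)]
    linarith
  have key : ∀ U : Finset (Set X), (∀ A ∈ U, IsOpen A) →
      Set.univ ⊆ ⋃₀ (↑U : Set (Set X)) → ∀ᶠ n in atTop,
      Real.log (covNumOn Γ X Set.univ U (F n)) / (F n).card + c / 2 ≤ b n := by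
    intro U hUo hU
    obtain ⟨K, hK, hKE⟩ := part_one hactX hexpX hwsX hκ0 hκ T hTc hTequiv hTpre hV hVd hUo hU
    have hlim := (hF.2 K hK).mul_const (Real.log V.card)
    rw [zero_mul] at hlim
    filter_upwards [hlim.eventually (gt_mem_nhds (half_pos hc))] with n hn
    set D := (K.biUnion fun k => (F n).image fun t => k * t) ∆ (F n) with hD
    have h1 := hKE (F n) (F n ∪ D) (by
      intro k hk t ht
      rw [hD, Finset.mem_union, Finset.mem_symmDiff]
      by_cases hkt : k * t ∈ F n
      · exact Or.inl hkt
      · exact Or.inr (Or.inl ⟨Finset.mem_biUnion.2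
          ⟨k, hk, Finset.mem_image_of_mem _ ht⟩, hkt⟩))
    have h2 := h1.trans (covNumOn_union_le (Set.range_nonempty T) hV subset_rfl)
    have hp1 : (0 : ℝ) < covNumOn Γ X Set.univ U (F n) := by
      exact_mod_cast covNumOn_pos Set.univ_nonempty hU (F n)
    have hp2 : (0 : ℝ) < covNumOn Γ Y (Set.range T) V (F n) := by
      exact_mod_cast covNumOn_pos (Set.range_nonempty T) hV (F n)
    have hp3 : (0 : ℝ) < V.card := by
      obtain ⟨A, hA, -⟩ := hV (Set.mem_univ (T x₀))
      exact_mod_cast Finset.card_pos.2 ⟨A, hA⟩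
    have h3 : (covNumOn Γ X Set.univ U (F n) : ℝ) ≤
        covNumOn Γ Y (Set.range T) V (F n) * (V.card : ℝ) ^ D.card := by exact_mod_cast h2
    have h4 := Real.log_le_log hp1 h3
    rw [Real.log_mul hp2.ne' (by positivity), Real.log_pow] at h4
    have h5 := hV'E (F n)
    have hn' : D.card * Real.log V.card < c / 2 * (F n).card := by
      rw [div_mul_eq_mul_div, div_lt_iff₀ (hFpos n)] at hn
      exact hn
    simp only [b]
    rw [le_div_iff₀ (hFpos n), add_mul, div_mul_cancel₀ _ (hFpos n).ne']
    linarith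
  -- the entropy is a real number
  have hle : topEntOn Γ X Set.univ F ≤ ((Real.log V'.card : ℝ) : EReal) := by
    refine iSup₂_le fun U hU => ?_
    refine Filter.limsup_le_of_le (by isBoundedDefault) ?_
    filter_upwards [key U hU.1 hU.2] with n hn
    have := hb n
    exact EReal.coe_le_coe_iff.2 (by linarith)
  have hge : (0 : EReal) ≤ topEntOn Γ X Set.univ F := by
    refine le_trans ?_ (le_iSup₂ (f := fun (U : Finset (Set X))
      (_ : (∀ V ∈ U, IsOpen V) ∧ Set.univ ⊆ ⋃₀ (↑U : Set (Set X))) => Filter.limsup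
      (fun n => ((Real.log (covNumOn Γ X Set.univ U (F n)) / (F n).card : ℝ) : EReal))
        Filter.atTop) {Set.univ} ⟨by simp, by simp⟩)
    refine Filter.le_limsup_of_frequently_le (Filter.Frequently.of_forall fun n => ?_)
      (by isBoundedDefault)
    have : (0 : ℝ) ≤ Real.log (covNumOn Γ X Set.univ {Set.univ} (F n)) / (F n).card :=
      div_nonneg (Real.log_natCast_nonneg _) (hFpos n).le
    exact_mod_cast this
  obtain ⟨r, hr⟩ : ∃ r : ℝ, topEntOn Γ X Set.univ F = (r : EReal) := by
    refine ⟨(topEntOn Γ X Set.univ F).toReal, (EReal.coe_toReal ?_ ?_).symm⟩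
    · exact ne_top_of_le_ne_top (EReal.coe_ne_top _) hle
    · exact ne_bot_of_le_ne_bot EReal.zero_ne_bot hge
  have hlimb : Filter.limsup (fun n => ((b n : ℝ) : EReal)) atTop < ((r + c / 4 : ℝ) : EReal) := by
    refine lt_of_le_of_lt ?_ (EReal.coe_lt_coe_iff.2 (show r < r + c / 4 by linarith))
    rw [← hr, hent]
    exact le_iSup₂ (f := fun (U : Finset (Set Y))
      (_ : (∀ V ∈ U, IsOpen V) ∧ Set.univ ⊆ ⋃₀ (↑U : Set (Set Y))) => Filter.limsup
      (fun n => ((Real.log (covNumOn Γ Y Set.univ U (F n)) / (F n).card : ℝ) : EReal))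
        Filter.atTop) V' ⟨hVo', hV'⟩
  have hevb := Filter.eventually_lt_of_limsup_lt hlimb
  have hfin : topEntOn Γ X Set.univ F ≤ ((r - c / 4 : ℝ) : EReal) := by
    refine iSup₂_le fun U hU => ?_
    refine Filter.limsup_le_of_le (by isBoundedDefault) ?_
    filter_upwards [key U hU.1 hU.2, hevb] with n hn hn2
    have := EReal.coe_lt_coe_iff.1 hn2
    exact EReal.coe_le_coe_iff.2 (by linarith)
  rw [hr] at hfin
  have := EReal.coe_le_coe_iff.1 hfin
  linarith
end

section
/- Every expansive continuous action of a countable amenable group on a compact metrizable space with the weak specification property has the Myhill property: for every continuous Γ-equivariant map T from the space to itself, pre-injectivity of T implies surjectivity of T. In particular, such actions are surjunctive: every injective continuous Γ-equivariant self-map is surjective. -/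
open Filter Topology MeasureTheory
open scoped symmDiff

open GOE

namespace MyhillAux

section
variable {Γ X : Type*} [Group Γ] [MetricSpace X] [MulAction Γ X]

/-- `W` is a subset of `Z` which is strictly `δ`-separated along `E`. -/
def Sep (Z : Set X) (E : Finset Γ) (δ : ℝ) (W : Finset X) : Prop :=
  (↑W : Set X) ⊆ Z ∧ ∀ x ∈ W, ∀ y ∈ W, x ≠ y → ∃ s ∈ E, δ < dist (s • x) (s • y)

/-- Largest cardinality of a strictly separated set. -/
noncomputable def N (Z : Set X) (E : Finset Γ) (δ : ℝ) : ℕ :=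
  sSup {n : ℕ | ∃ W : Finset X, Sep Z E δ W ∧ W.card = n}

theorem exists_coloring [CompactSpace X] {δ : ℝ} (hδ : 0 < δ) :
    ∃ (C : ℕ) (c : X → Fin C), ∀ x y, c x = c y → dist x y ≤ δ := by
  obtain ⟨t, htf, ht⟩ := Metric.totallyBounded_iff.1
    (isCompact_univ (X := X)).totallyBounded (δ / 2) (half_pos hδ)
  have h : ∀ x : X, ∃ p : t, dist x p < δ / 2 := by
    intro x
    have := ht (Set.mem_univ x)
    simp only [Set.mem_iUnion, Metric.mem_ball] at this
    obtain ⟨p, hp, hx⟩ := this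
    exact ⟨⟨p, hp⟩, hx⟩
  choose f hf using h
  haveI : Fintype t := htf.fintype
  refine ⟨Fintype.card t, fun x => Fintype.equivFin t (f x), fun x y hxy => ?_⟩
  have h1 : f x = f y := (Fintype.equivFin t).injective hxy
  have h2 := hf x
  have h3 := hf y
  rw [← h1] at h3
  have := dist_triangle_right x y (f x : X)
  linarith

theorem sep_card_le {Z : Set X} {E : Finset Γ} {δ : ℝ} {W : Finset X} (hW : Sep Z E δ W)
    {C : ℕ} (c : X → Fin C) (hc : ∀ x y, c x = c y → dist x y ≤ δ) :
    W.card ≤ C ^ E.card := by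
  classical
  have : W.card ≤ (Finset.univ : Finset (E → Fin C)).card := by
    refine Finset.card_le_card_of_injOn (fun x (s : E) => c ((s : Γ) • x)) (by simp) ?_
    intro x hx y hy hxy
    by_contra hne
    obtain ⟨s, hs, hd⟩ := hW.2 x hx y hy hne
    have := hc _ _ (congrFun hxy ⟨s, hs⟩)
    linarith
  simpa using this

theorem bdd [CompactSpace X] (Z : Set X) (E : Finset Γ) {δ : ℝ} (hδ : 0 < δ) :
    BddAbove {n : ℕ | ∃ W : Finset X, Sep Z E δ W ∧ W.card = n} := by
  obtain ⟨C, c, hc⟩ := exists_coloring (X := X) hδ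
  refine ⟨C ^ E.card, ?_⟩
  rintro n ⟨W, hW, rfl⟩
  exact sep_card_le hW c hc

theorem le_N [CompactSpace X] {Z : Set X} {E : Finset Γ} {δ : ℝ} (hδ : 0 < δ) {W : Finset X}
    (hW : Sep Z E δ W) : W.card ≤ N Z E δ :=
  le_csSup (bdd Z E hδ) ⟨W, hW, rfl⟩

theorem exists_max [CompactSpace X] (Z : Set X) (E : Finset Γ) {δ : ℝ} (hδ : 0 < δ) :
    ∃ W : Finset X, Sep Z E δ W ∧ W.card = N Z E δ := by
  have hne : {n : ℕ | ∃ W : Finset X, Sep Z E δ W ∧ W.card = n}.Nonempty :=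
    ⟨0, ∅, ⟨by simp, by simp⟩, rfl⟩
  exact Nat.sSup_mem hne (bdd Z E hδ)

theorem N_pos [CompactSpace X] {Z : Set X} (hZ : Z.Nonempty) (E : Finset Γ) {δ : ℝ}
    (hδ : 0 < δ) : 1 ≤ N Z E δ := by
  obtain ⟨z, hz⟩ := hZ
  refine le_N hδ (W := {z}) ⟨by simpa using hz, ?_⟩
  intro x hx y hy hxy
  simp at hx hy
  exact absurd (hx.trans hy.symm) hxy

/-- A maximal separated set is spanning. -/
theorem spanning [CompactSpace X] {Z : Set X} {E : Finset Γ} {δ : ℝ} (hδ : 0 < δ)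
    {V : Finset X} (hV : Sep Z E δ V) (hcard : V.card = N Z E δ) {w : X} (hw : w ∈ Z) :
    ∃ v ∈ V, ∀ s ∈ E, dist (s • w) (s • v) ≤ δ := by
  classical
  by_contra hcon
  push Not at hcon
  by_cases hwV : w ∈ V
  · obtain ⟨s, _, h⟩ := hcon w hwV
    simp at h
    linarith
  have : Sep Z E δ (insert w V) := by
    refine ⟨?_, ?_⟩
    · intro x hx
      simp at hx
      rcases hx with rfl | hx
      · exact hw
      · exact hV.1 hx
    · intro x hx y hy hxy
      rw [Finset.mem_insert] at hx hy
      rcases hx with rfl | hx <;> rcases hy with rfl | hy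
      · exact absurd rfl hxy
      · exact hcon y hy
      · obtain ⟨s, hs, h⟩ := hcon x hx
        exact ⟨s, hs, by rwa [dist_comm]⟩
      · exact hV.2 x hx y hy hxy
  have h := le_N hδ this
  rw [Finset.card_insert_of_notMem hwV] at h
  omega

theorem glue [CompactSpace X] {Z : Set X} {E E' A : Finset Γ} {δ : ℝ} (hδ : 0 < δ)
    {C : ℕ} (c : X → Fin C) (hc : ∀ x y, c x = c y → dist x y ≤ 2 * δ)
    (hA : ∀ s ∈ A, s ∈ E ∨ s ∈ E') :
    N Z A (2 * δ) ≤ N Z E δ * C ^ E'.card := by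
  classical
  obtain ⟨W, hW, hWc⟩ := exists_max Z A (δ := 2 * δ) (by linarith)
  obtain ⟨V, hV, hVc⟩ := exists_max Z E hδ
  rw [← hWc, ← hVc]
  have h : ∀ w : W, ∃ v : V, ∀ s ∈ E, dist (s • (w : X)) (s • (v : X)) ≤ δ := by
    intro w
    obtain ⟨v, hv, h⟩ := spanning hδ hV hVc (hW.1 w.2)
    exact ⟨⟨v, hv⟩, h⟩
  choose f hf using h
  have : Function.Injective
      (fun w : W => ((f w, fun s : E' => c ((s : Γ) • (w : X))) : V × (E' → Fin C))) := by
    intro w w' hww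
    simp only [Prod.mk.injEq] at hww
    by_contra hne
    obtain ⟨s, hs, hd⟩ := hW.2 w w.2 w' w'.2 (fun h => hne (Subtype.ext h))
    rcases hA s hs with h | h
    · have h1 := hf w s h
      have h2 := hf w' s h
      rw [← hww.1] at h2
      have := dist_triangle_right (s • (w : X)) (s • (w' : X)) (s • (f w : X))
      linarith
    · have := hc _ _ (congrFun hww.2 ⟨s, h⟩)
      simp only at this
      linarith
  simpa using Fintype.card_le_of_injective _ this

/-- What weak specification says for one scale. -/
def Spec (X : Type*) [MetricSpace X] [MulAction Γ X] (M : Finset Γ) (ε : ℝ) : Prop :=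
  ∀ (J : Type) (_ : Fintype J) (Fj : J → Finset Γ),
      (∀ i j : J, i ≠ j → ∀ f ∈ M, ∀ s ∈ Fj i, f * s ∉ Fj j) →
      ∀ xj : J → X, ∃ x : X, ∀ j : J, ∀ s ∈ Fj j, dist (s • x) (s • xj j) ≤ ε

theorem Spec.univ {M : Finset Γ} {ε : ℝ} (h : Spec X M ε) {J : Type*} [Fintype J]
    (Fj : J → Finset Γ)
    (hF : ∀ i j : J, i ≠ j → ∀ f ∈ M, ∀ s ∈ Fj i, f * s ∉ Fj j) (xj : J → X) :
    ∃ x : X, ∀ j : J, ∀ s ∈ Fj j, dist (s • x) (s • xj j) ≤ ε := by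
  let e := Fintype.equivFin J
  obtain ⟨x, hx⟩ := h (Fin (Fintype.card J)) inferInstance (fun i => Fj (e.symm i))
    (fun i j hij => hF _ _ (fun h => hij (e.symm.injective h))) (fun i => xj (e.symm i))
  refine ⟨x, fun j => ?_⟩
  have := hx (e j)
  simpa using this

/-- The counting part: if `x0` is far from the set `Y`, then `X` has many more orbits than `Y`. -/
theorem count [CompactSpace X] {M : Finset Γ} {ε : ℝ} (hε : 0 < ε) (hM1 : (1 : Γ) ∈ M)
    (hMs : ∀ s ∈ M, s⁻¹ ∈ M) (hS : Spec X M ε) {Y : Set X} (hinv : ∀ (s : Γ), ∀ y ∈ Y, s • y ∈ Y)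
    {x0 : X} (hx0 : ∀ y ∈ Y, 4 * ε < dist x0 y)
    {C : ℕ} (hC : 0 < C) (c : X → Fin C) (hc : ∀ x y, c x = c y → dist x y ≤ 8 * ε)
    (E D : Finset Γ) (hDE : D ⊆ E) (hD : ∀ d ∈ D, ∀ d' ∈ D, d ≠ d' → ∀ m ∈ M, m * d ≠ d') :
    (N Y E (8 * ε) : ℝ) * (1 + ((C : ℝ) ^ M.card)⁻¹) ^ D.card ≤
      N (Set.univ : Set X) E (2 * ε) := by
  classical
  let MS : Finset Γ → Finset Γ := fun S => M.biUnion fun k => S.image fun t => k * t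
  have hMS : ∀ S s, s ∈ MS S ↔ ∃ m ∈ M, ∃ t ∈ S, m * t = s := by
    intro S s; simp only [MS, Finset.mem_biUnion, Finset.mem_image]
  have hmax := fun S : Finset Γ => exists_max Y (E \ MS S) (δ := 4 * ε) (by linarith)
  choose V hV hVc using hmax
  have hpt : ∀ (S : Finset Γ) (y : X), S ⊆ D → ∃ x : X,
      (∀ s ∈ E \ MS S, dist (s • x) (s • y) ≤ ε) ∧ ∀ d ∈ S, dist (d • x) x0 ≤ ε := by
    intro S y hSD
    let Fj : Option S → Finset Γ := fun j => j.elim (E \ MS S) (fun d => {(d : Γ)})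
    have hFj : ∀ i j : Option S, i ≠ j → ∀ f ∈ M, ∀ s ∈ Fj i, f * s ∉ Fj j := by
      rintro (_ | i) (_ | j) hij m hm s hs
      · exact absurd rfl hij
      · simp only [Fj, Option.elim] at hs ⊢
        intro h
        rw [Finset.mem_singleton] at h
        refine (Finset.mem_sdiff.1 hs).2 ((hMS _ _).2 ⟨m⁻¹, hMs m hm, j, j.2, ?_⟩)
        rw [← h]; group
      · simp only [Fj, Option.elim, Finset.mem_singleton] at hs ⊢
        intro h
        exact (Finset.mem_sdiff.1 h).2 ((hMS _ _).2 ⟨m, hm, i, i.2, by rw [hs]⟩)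
      · simp only [Fj, Option.elim, Finset.mem_singleton] at hs ⊢
        rw [hs]
        exact hD i (hSD i.2) j (hSD j.2) (fun h => hij (by rw [Subtype.ext h])) m hm
    obtain ⟨x, hx⟩ := hS.univ (J := Option S)
      Fj hFj
      (fun j => j.elim y (fun d => (d : Γ)⁻¹ • x0))
    refine ⟨x, fun s hs => hx none s hs, fun d hd => ?_⟩
    have := hx (some ⟨d, hd⟩) d (by simp [Fj])
    simpa using this
  have hpt' : ∀ (S : Finset Γ) (y : X), ∃ x : X, S ⊆ D →
      (∀ s ∈ E \ MS S, dist (s • x) (s • y) ≤ ε) ∧ ∀ d ∈ S, dist (d • x) x0 ≤ ε := by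
    intro S y
    by_cases h : S ⊆ D
    · obtain ⟨x, hx⟩ := hpt S y h
      exact ⟨x, fun _ => hx⟩
    · exact ⟨y, fun h' => absurd h' h⟩
  choose f hf using hpt'
  let P : Finset (Σ _ : Finset Γ, X) := D.powerset.sigma V
  have hPmem : ∀ p ∈ P, p.1 ⊆ D ∧ p.2 ∈ V p.1 := by
    intro p hp
    simpa [P] using hp
  have hhalf : ∀ p ∈ P, ∀ q ∈ P, ∀ d ∈ p.1, d ∉ q.1 →
      ∃ s ∈ E, 2 * ε < dist (s • f p.1 p.2) (s • f q.1 q.2) := by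
    intro p hp q hq d hd hdq
    obtain ⟨hp1, hp2⟩ := hPmem p hp
    obtain ⟨hq1, hq2⟩ := hPmem q hq
    refine ⟨d, hDE (hp1 hd), ?_⟩
    have h1 := (hf p.1 p.2 hp1).2 d hd
    have h2 := (hf q.1 q.2 hq1).1 d (by
      rw [Finset.mem_sdiff, hMS]
      refine ⟨hDE (hp1 hd), ?_⟩
      rintro ⟨m, hm, t, ht, h⟩
      exact hD t (hq1 ht) d (hp1 hd) (fun h => hdq (h ▸ ht)) m hm h)
    have h3 := hx0 (d • q.2) (hinv d _ ((hV _).1 hq2))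
    have h4 := dist_triangle4 x0 (d • f p.1 p.2) (d • f q.1 q.2) (d • q.2)
    rw [dist_comm x0 (d • f p.1 p.2)] at h4
    linarith
  have hsep : ∀ p ∈ P, ∀ q ∈ P, p ≠ q →
      ∃ s ∈ E, 2 * ε < dist (s • f p.1 p.2) (s • f q.1 q.2) := by
    intro p hp q hq hpq
    by_cases h1 : ∃ d ∈ p.1, d ∉ q.1
    · obtain ⟨d, hd, hd'⟩ := h1
      exact hhalf p hp q hq d hd hd'
    by_cases h2 : ∃ d ∈ q.1, d ∉ p.1
    · obtain ⟨d, hd, hd'⟩ := h2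
      obtain ⟨s, hs, h⟩ := hhalf q hq p hp d hd hd'
      exact ⟨s, hs, by rwa [dist_comm]⟩
    push Not at h1 h2
    have hS : p.1 = q.1 := Finset.Subset.antisymm h1 h2
    obtain ⟨S, y⟩ := p
    obtain ⟨S', y'⟩ := q
    simp only at hS
    subst hS
    obtain ⟨hp1, hp2⟩ := hPmem _ hp
    obtain ⟨hq1, hq2⟩ := hPmem _ hq
    simp only at hp1 hp2 hq2 ⊢
    have hne : y ≠ y' := fun h => hpq (by rw [h])
    obtain ⟨s, hs, hd⟩ := (hV S).2 y hp2 y' hq2 hne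
    refine ⟨s, (Finset.mem_sdiff.1 hs).1, ?_⟩
    have h1 := (hf S y hp1).1 s hs
    have h2 := (hf S y' hp1).1 s hs
    have h3 := dist_triangle4 (s • y) (s • f S y) (s • f S y') (s • y')
    rw [dist_comm (s • y) (s • f S y)] at h3
    linarith
  have hinj : Set.InjOn (fun p : (Σ _ : Finset Γ, X) => f p.1 p.2) P := by
    intro p hp q hq hpq
    by_contra hne
    obtain ⟨s, _, h⟩ := hsep p hp q hq hne
    simp only at hpq
    rw [hpq, dist_self] at h
    linarith
  have hcardP : P.card ≤ N (Set.univ : Set X) E (2 * ε) := by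
    rw [← Finset.card_image_of_injOn hinj]
    refine le_N (by linarith) ⟨Set.subset_univ _, ?_⟩
    intro x hx y hy hxy
    rw [Finset.mem_image] at hx hy
    obtain ⟨p, hp, rfl⟩ := hx
    obtain ⟨q, hq, rfl⟩ := hy
    exact hsep p hp q hq (fun h => hxy (by rw [h]))
  have hVS : ∀ S : Finset Γ,
      (N Y E (8 * ε) : ℝ) * (((C : ℝ) ^ M.card)⁻¹) ^ S.card ≤ (V S).card := by
    intro S
    have h1 : N Y E (2 * (4 * ε)) ≤ N Y (E \ MS S) (4 * ε) * C ^ (MS S).card :=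
      glue (by linarith) c (fun x y h => by have := hc x y h; linarith)
        (fun s hs => by
          by_cases h : s ∈ MS S
          · exact Or.inr h
          · exact Or.inl (Finset.mem_sdiff.2 ⟨hs, h⟩))
    have h2 : (MS S).card ≤ M.card * S.card := by
      refine Finset.card_biUnion_le_card_mul _ _ _ (fun k _ => Finset.card_image_le)
    have h3 : N Y E (8 * ε) ≤ (V S).card * C ^ (M.card * S.card) := by
      have e : (8 * ε) = 2 * (4 * ε) := by ring
      rw [e, hVc]
      exact h1.trans (Nat.mul_le_mul_left _ (Nat.pow_le_pow_right hC h2))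
    have h4 : (N Y E (8 * ε) : ℝ) ≤ (V S).card * (C : ℝ) ^ (M.card * S.card) := by
      exact_mod_cast h3
    have hCp : (0 : ℝ) < (C : ℝ) ^ (M.card * S.card) := by positivity
    rw [inv_pow, ← pow_mul, ← div_eq_mul_inv, div_le_iff₀ hCp]
    exact h4
  calc (N Y E (8 * ε) : ℝ) * (1 + ((C : ℝ) ^ M.card)⁻¹) ^ D.card
      = ∑ S ∈ D.powerset, (N Y E (8 * ε) : ℝ) * (((C : ℝ) ^ M.card)⁻¹) ^ S.card := by
        rw [add_comm, ← Finset.sum_pow_mul_eq_add_pow, Finset.mul_sum]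
        simp
    _ ≤ ∑ S ∈ D.powerset, ((V S).card : ℝ) := Finset.sum_le_sum fun S _ => hVS S
    _ = (P.card : ℝ) := by simp [P, Finset.card_sigma]
    _ ≤ _ := by exact_mod_cast hcardP

/-- Following `w` on `E` and `z` away from `A = M E`. -/
theorem spec_tail [CompactSpace X] (hact : ContAction Γ X) {M : Finset Γ} {ε : ℝ}
    (hMs : ∀ s ∈ M, s⁻¹ ∈ M) (hS : Spec X M ε) {E A : Finset Γ}
    (hA : ∀ s, (∃ m ∈ M, ∃ t ∈ E, m * t = s) → s ∈ A) (w z : X) :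
    ∃ x : X, (∀ s ∈ E, dist (s • x) (s • w) ≤ ε) ∧ ∀ s ∉ A, dist (s • x) (s • z) ≤ ε := by
  classical
  let K : Finset Γ → Set X := fun G =>
    {x | (∀ s ∈ E, dist (s • x) (s • w) ≤ ε) ∧ ∀ s ∈ G, s ∉ A → dist (s • x) (s • z) ≤ ε}
  have hcl : ∀ G, IsClosed (K G) := by
    intro G
    have e : K G = (⋂ s ∈ E, {x | dist (s • x) (s • w) ≤ ε}) ∩
        ⋂ s ∈ G, ⋂ (_ : s ∉ A), {x | dist (s • x) (s • z) ≤ ε} := by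
      ext x; simp [K]
    rw [e]
    have hc : ∀ (s : Γ) (y : X), IsClosed {x | dist (s • x) (s • y) ≤ ε} := fun s y =>
      isClosed_le ((hact s).dist continuous_const) continuous_const
    exact (isClosed_biInter fun s _ => hc s w).inter
      (isClosed_biInter fun s _ => isClosed_iInter fun _ => hc s z)
  have hne : ∀ G, (K G).Nonempty := by
    intro G
    obtain ⟨x, hx⟩ := hS.univ (J := Bool) (fun b => if b then E else G \ A) (by
      rintro (_ | _) (_ | _) hij m hm s hs h
      · exact hij rfl
      · simp at hs h
        exact hs.2 (hA s ⟨m⁻¹, hMs m hm, m * s, h, by group⟩)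
      · simp at hs h
        exact h.2 (hA _ ⟨m, hm, s, hs, rfl⟩)
      · exact hij rfl) (fun b => if b then w else z)
    refine ⟨x, fun s hs => ?_, fun s hs hsA => ?_⟩
    · simpa using hx true s (by simpa using hs)
    · simpa using hx false s (by simpa using ⟨hs, hsA⟩)
  obtain ⟨x, hx⟩ := IsCompact.nonempty_iInter_of_directed_nonempty_isCompact_isClosed K
    (fun G G' => ⟨G ∪ G',
      fun x hx => ⟨hx.1, fun s hs => hx.2 s (Finset.mem_union_left _ hs)⟩,
      fun x hx => ⟨hx.1, fun s hs => hx.2 s (Finset.mem_union_right _ hs)⟩⟩)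
    hne (fun G => (hcl G).isCompact) hcl
  rw [Set.mem_iInter] at hx
  exact ⟨x, (hx ∅).1, fun s hs => (hx {s}).2 s (by simp) hs⟩

/-- Uniform expansiveness. -/
theorem expansive_unif [CompactSpace X] (hact : ContAction Γ X) {κ : ℝ}
    (hκ : ∀ x y : X, x ≠ y → ∃ s : Γ, κ < dist (s • x) (s • y)) {η : ℝ} (hη : 0 < η) :
    ∃ K : Finset Γ, ∀ x y : X, (∀ s ∈ K, dist (s • x) (s • y) ≤ κ) → dist x y < η := by
  classical
  have hcomp : IsCompact {p : X × X | η ≤ dist p.1 p.2} :=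
    (isClosed_le continuous_const continuous_dist).isCompact
  obtain ⟨K, hK⟩ := hcomp.elim_finite_subcover
    (fun s : Γ => {p : X × X | κ < dist (s • p.1) (s • p.2)})
    (fun s => isOpen_lt continuous_const
      (((hact s).comp continuous_fst).dist ((hact s).comp continuous_snd)))
    (by
      rintro ⟨x, y⟩ hp
      simp only [Set.mem_ofPred_eq] at hp
      have : x ≠ y := by
        rintro rfl
        simp at hp
        linarith
      simpa using hκ x y this)
  refine ⟨K, fun x y h => ?_⟩
  by_contra hcon
  push Not at hcon
  have := hK (show (x, y) ∈ {p : X × X | η ≤ dist p.1 p.2} from hcon)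
  simp only [Set.mem_iUnion, Set.mem_ofPred_eq] at this
  obtain ⟨s, hs, hd⟩ := this
  have := h s hs
  linarith

theorem homoclinic_of_tail [CompactSpace X] (hact : ContAction Γ X) {κ : ℝ}
    (hκ : ∀ x y : X, x ≠ y → ∃ s : Γ, κ < dist (s • x) (s • y)) {A : Finset Γ} {x y : X}
    (h : ∀ s ∉ A, dist (s • x) (s • y) ≤ κ) : Homoclinic Γ x y := by
  classical
  intro η hη
  obtain ⟨K, hK⟩ := expansive_unif hact hκ hη
  refine ⟨K.biUnion fun k => A.image fun a => k⁻¹ * a, fun s hs => hK _ _ fun k hk => ?_⟩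
  rw [← mul_smul, ← mul_smul]
  refine h _ fun hA => hs ?_
  simp only [Finset.mem_biUnion, Finset.mem_image]
  exact ⟨k, hk, k * s, hA, by group⟩

theorem transfer [CompactSpace X] (hact : ContAction Γ X) {κ : ℝ}
    (hκ : ∀ x y : X, x ≠ y → ∃ s : Γ, κ < dist (s • x) (s • y)) {T : X → X}
    (heq : ∀ (s : Γ) (x : X), T (s • x) = s • T x) (hpre : PreInjective Γ T)
    {M : Finset Γ} {ε : ℝ} (hε : 0 < ε) (hεκ : 16 * ε ≤ κ)
    (hT : ∀ x y, dist x y ≤ 2 * ε → dist (T x) (T y) ≤ κ)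
    (hMs : ∀ s ∈ M, s⁻¹ ∈ M) (hS : Spec X M ε) {E A : Finset Γ}
    (hA : ∀ s, (∃ m ∈ M, ∃ t ∈ E, m * t = s) → s ∈ A) (z : X) :
    N (Set.univ : Set X) E (2 * ε) ≤ N (Set.range T) A (16 * ε) := by
  classical
  obtain ⟨W, hW, hWc⟩ := exists_max (Set.univ : Set X) E (δ := 2 * ε) (by linarith)
  have h := fun w : X => spec_tail hact hMs hS hA w z
  choose f hf1 hf2 using h
  have htail : ∀ w w', ∀ s ∉ A, dist (s • f w) (s • f w') ≤ 2 * ε := by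
    intro w w' s hs
    have := dist_triangle_right (s • f w) (s • f w') (s • z)
    have h1 := hf2 w s hs
    have h2 := hf2 w' s hs
    linarith
  have key : ∀ w ∈ W, ∀ w' ∈ W, w ≠ w' →
      ∃ s ∈ A, 16 * ε < dist (s • T (f w)) (s • T (f w')) := by
    intro w hw w' hw' hne
    by_contra hcon
    push Not at hcon
    have hTT : T (f w) = T (f w') := by
      by_contra hTne
      obtain ⟨s, hs⟩ := hκ _ _ hTne
      by_cases hsA : s ∈ A
      · have := hcon s hsA
        linarith
      · have := hT _ _ (htail w w' s hsA)
        rw [heq, heq] at this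
        linarith
    have hfe : f w = f w' := hpre _ _ (homoclinic_of_tail hact hκ (A := A) (fun s hs => by
      have := htail w w' s hs
      linarith)) hTT
    obtain ⟨s, hs, hd⟩ := hW.2 w hw w' hw' hne
    have h1 := hf1 w s hs
    have h2 := hf1 w' s hs
    rw [← hfe] at h2
    have := dist_triangle_left (s • w) (s • w') (s • f w)
    linarith
  have hinj : Set.InjOn (fun w => T (f w)) W := by
    intro w hw w' hw' h
    by_contra hne
    obtain ⟨s, _, hd⟩ := key w hw w' hw' hne
    simp only at h
    rw [h, dist_self] at hd
    linarith
  rw [← hWc, ← Finset.card_image_of_injOn hinj]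
  refine le_N (by linarith) ⟨?_, ?_⟩
  · intro x hx
    simp only [Finset.coe_image, Set.mem_image] at hx
    obtain ⟨w, _, rfl⟩ := hx
    exact ⟨_, rfl⟩
  · intro x hx y hy hxy
    rw [Finset.mem_image] at hx hy
    obtain ⟨w, hw, rfl⟩ := hx
    obtain ⟨w', hw', rfl⟩ := hy
    exact key w hw w' hw' (fun h => hxy (by rw [h]))

/-- A large `M`-separated subset. -/
theorem exists_net {M : Finset Γ} (hM1 : (1 : Γ) ∈ M) (hMs : ∀ s ∈ M, s⁻¹ ∈ M) (E : Finset Γ) :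
    ∃ D ⊆ E, (∀ d ∈ D, ∀ d' ∈ D, d ≠ d' → ∀ m ∈ M, m * d ≠ d') ∧
      E.card ≤ M.card * D.card := by
  classical
  let Q := E.powerset.filter fun D => ∀ d ∈ D, ∀ d' ∈ D, d ≠ d' → ∀ m ∈ M, m * d ≠ d'
  obtain ⟨D, hD, hmax⟩ := Q.exists_max_image Finset.card ⟨∅, by simp [Q]⟩
  simp only [Q, Finset.mem_filter, Finset.mem_powerset] at hD hmax
  refine ⟨D, hD.1, hD.2, ?_⟩
  have hsub : E ⊆ M.biUnion fun k => D.image fun t => k * t := by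
    intro e he
    simp only [Finset.mem_biUnion, Finset.mem_image]
    by_contra hcon
    push Not at hcon
    have heD : e ∉ D := fun h => hcon 1 hM1 e h (one_mul e)
    have := hmax (insert e D) ⟨Finset.insert_subset he hD.1, by
      intro d hd d' hd' hne m hm
      rw [Finset.mem_insert] at hd hd'
      rcases hd with rfl | hd <;> rcases hd' with rfl | hd'
      · exact absurd rfl hne
      · intro h
        exact hcon m⁻¹ (hMs m hm) d' hd' (by rw [← h]; group)
      · exact hcon m hm d hd
      · exact hD.2 d hd d' hd' hne m hm⟩
    rw [Finset.card_insert_of_notMem heD] at this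
    omega
  exact (Finset.card_le_card hsub).trans
    (Finset.card_biUnion_le_card_mul _ _ _ (fun k _ => Finset.card_image_le))

theorem main [CompactSpace X] (hact : ContAction Γ X)
    (F : ℕ → Finset Γ) (hF : IsFolner Γ F)
    (hexp : Expansive Γ X) (hws : WeakSpec Γ X) (T : X → X) (hTc : Continuous T)
    (heq : ∀ (s : Γ) (x : X), T (s • x) = s • T x) (hpre : PreInjective Γ T) :
    Function.Surjective T := by
  intro x0
  by_contra hx0
  have hx0' : x0 ∉ Set.range T := hx0
  obtain ⟨κ, hκ0, hκ⟩ := hexp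
  obtain ⟨r, hr0, hr⟩ : ∃ r > 0, ∀ y ∈ Set.range T, r ≤ dist x0 y := by
    have hcl : IsClosed (Set.range T) := (isCompact_range hTc).isClosed
    obtain ⟨r, hr0, hr⟩ := Metric.isOpen_iff.1 hcl.isOpen_compl x0 hx0'
    refine ⟨r, hr0, fun y hy => ?_⟩
    by_contra h
    push Not at h
    exact hr (Metric.mem_ball'.2 h) hy
  obtain ⟨η, hη0, hη⟩ := Metric.uniformContinuous_iff.1
    (CompactSpace.uniformContinuous_of_continuous hTc) κ hκ0
  obtain ⟨ε, hε, h1, h2, h3⟩ : ∃ ε > 0, 16 * ε ≤ κ ∧ 4 * ε < r ∧ 2 * ε < η := by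
    have hm : 0 < min κ (min r η) := lt_min hκ0 (lt_min hr0 hη0)
    have a1 := min_le_left κ (min r η)
    have a2 := (min_le_right κ (min r η)).trans (min_le_left r η)
    have a3 := (min_le_right κ (min r η)).trans (min_le_right r η)
    exact ⟨min κ (min r η) / 16, by positivity, by linarith, by linarith, by linarith⟩
  obtain ⟨M0, -, hM0s, hM0⟩ := hws ε hε
  letI : DecidableEq Γ := Classical.decEq Γ
  obtain ⟨M, hM1, hMs, hS⟩ : ∃ M : Finset Γ, (1 : Γ) ∈ M ∧ (∀ s ∈ M, s⁻¹ ∈ M) ∧ Spec X M ε := by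
    refine ⟨insert 1 M0, by simp, ?_, ?_⟩
    · intro s hs
      rw [Finset.mem_insert] at hs ⊢
      rcases hs with rfl | hs
      · simp
      · exact Or.inr (hM0s s hs)
    · intro J hJ Fj hFj
      exact hM0 J hJ Fj fun i j hij f hf => hFj i j hij f (Finset.mem_insert_of_mem hf)
  obtain ⟨C, c, hc⟩ := exists_coloring (X := X) (δ := 8 * ε) (by linarith)
  have hC : 0 < C := (Nat.zero_le _).trans_lt (c x0).2
  set θ : ℝ := ((C : ℝ) ^ M.card)⁻¹ with hθ
  have hθ0 : 0 < θ := by positivity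
  have hlog : 0 < Real.log (1 + θ) := Real.log_pos (by linarith)
  have hMc : 0 < (M.card : ℝ) := by exact_mod_cast Finset.card_pos.2 ⟨1, hM1⟩
  obtain ⟨hFne, hFl⟩ := hF
  have hlim := (hFl M ⟨1, hM1⟩).mul_const (Real.log C)
  rw [zero_mul] at hlim
  have hbound : ∀ n, Real.log (1 + θ) / M.card ≤
      ((((M.biUnion fun k => (F n).image fun t => k * t) ∆ (F n)).card : ℝ) / (F n).card)
        * Real.log C := by
    intro n
    set E := F n
    set A := M.biUnion fun k => E.image fun t => k * t with hAdef
    have hA : ∀ s, (∃ m ∈ M, ∃ t ∈ E, m * t = s) → s ∈ A := by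
      intro s hs
      simpa only [A, Finset.mem_biUnion, Finset.mem_image] using hs
    have hE0 : 0 < (E.card : ℝ) := by exact_mod_cast Finset.card_pos.2 (hFne n)
    obtain ⟨D, hDE, hD, hcard⟩ := exists_net hM1 hMs E
    have b1 := count hε hM1 hMs hS (Y := Set.range T)
      (by rintro s _ ⟨y, rfl⟩; exact ⟨s • y, heq s y⟩)
      (x0 := x0) (fun y hy => h2.trans_le (hr y hy)) hC c hc E D hDE hD
    have b2 := transfer hact hκ heq hpre hε h1
      (fun x y hxy => (hη (hxy.trans_lt h3)).le) hMs hS hA x0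
    have b3 : N (Set.range T) A (2 * (8 * ε)) ≤
        N (Set.range T) E (8 * ε) * C ^ (A ∆ E).card :=
      glue (by linarith) c (fun x y h => by have := hc x y h; linarith) (fun s hs => by
        by_cases h : s ∈ E
        · exact Or.inl h
        · exact Or.inr (Finset.mem_symmDiff.2 (Or.inl ⟨hs, h⟩)))
    have e : 2 * (8 * ε) = 16 * ε := by ring
    rw [e] at b3
    have b4 : (N (Set.univ : Set X) E (2 * ε) : ℝ) ≤
        N (Set.range T) E (8 * ε) * (C : ℝ) ^ (A ∆ E).card := by
      exact_mod_cast b2.trans b3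
    have b5 : (0 : ℝ) < N (Set.range T) E (8 * ε) := by
      have := N_pos (Z := Set.range T) ⟨T x0, x0, rfl⟩ E (δ := 8 * ε) (by linarith)
      exact_mod_cast this
    have b6 : (1 + θ) ^ D.card ≤ (C : ℝ) ^ (A ∆ E).card :=
      le_of_mul_le_mul_left (b1.trans b4) b5
    have b7 := Real.log_le_log (by positivity) b6
    rw [Real.log_pow, Real.log_pow] at b7
    have b8 : (E.card : ℝ) ≤ M.card * D.card := by exact_mod_cast hcard
    rw [div_mul_eq_mul_div, div_le_div_iff₀ hMc hE0]
    nlinarith [mul_le_mul_of_nonneg_left b8 hlog.le, mul_le_mul_of_nonneg_left b7 hMc.le]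
  have := ge_of_tendsto' hlim hbound
  have h0 : 0 < Real.log (1 + θ) / M.card := by positivity
  linarith

end

end MyhillAux

/-- expansive actions of amenable groups with weak specification
have the Myhill property; in particular they are surjunctive. -/
theorem myhill_property {Γ X : Type*} [Group Γ] [Countable Γ]
    [MetricSpace X] [CompactSpace X] [MulAction Γ X]
    (hact : ContAction Γ X)
    (F : ℕ → Finset Γ) (hF : IsFolner Γ F)
    (hexp : Expansive Γ X) (hws : WeakSpec Γ X) :
    (∀ T : X → X, Continuous T → (∀ (s : Γ) (x : X), T (s • x) = s • T x) →
      PreInjective Γ T → Function.Surjective T) ∧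
    (∀ T : X → X, Continuous T → (∀ (s : Γ) (x : X), T (s • x) = s • T x) →
      Function.Injective T → Function.Surjective T) := by
  refine ⟨fun T hTc heq hpre => MyhillAux.main hact F hF hexp hws T hTc heq hpre,
    fun T hTc heq hinj => MyhillAux.main hact F hF hexp hws T hTc heq
      (fun x y _ h => hinj h)⟩
end

section
/- Let Γ be a countable amenable group with Følner sequence {F_n} acting expansively on a compact metrizable space X, with expansive constant κ for a compatible metric ρ. Then for any 0 < ε < κ/4, the topological entropy satisfies h_top(X) = lim_n (1/|F_n|) log sep(X, ρ_{F_n}, ε) = lim_n (1/|F_n|) log spn(X, ρ_{F_n}, ε). -/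
open Filter Topology MeasureTheory
open scoped symmDiff

open GOE

namespace OWAux

open Classical in
/-- `Ω` is `(D, δ)`-invariant. -/
def Inv {Γ : Type*} [Group Γ] (D : Finset Γ) (δ : ℝ) (Ω : Finset Γ) : Prop :=
  ∀ d ∈ D, ((Ω.filter fun w => d * w ∉ Ω).card : ℝ) ≤ δ * Ω.card

open Classical in
/-- The product set `K R`. -/
noncomputable def prd {Γ : Type*} [Group Γ] (K R : Finset Γ) : Finset Γ :=
  R.biUnion fun r => K.image fun k => k * r

lemma mem_prd {Γ : Type*} [Group Γ] {K R : Finset Γ} {x : Γ} :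
    x ∈ prd K R ↔ ∃ r ∈ R, ∃ k ∈ K, k * r = x := by
  simp only [prd, Finset.mem_biUnion, Finset.mem_image]

open Classical in
lemma prd_insert {Γ : Type*} [Group Γ] (K R : Finset Γ) (g : Γ) :
    prd K (insert g R) = (K.image fun k => k * g) ∪ prd K R := by
  simp [prd, Finset.biUnion_insert]

open Classical in
lemma card_trans {Γ : Type*} [Group Γ] (K : Finset Γ) (g : Γ) :
    (K.image fun k => k * g).card = K.card :=
  Finset.card_image_of_injective _ (mul_left_injective g)

open Classical in
/-- Filling lemma. -/
lemma filling {Γ : Type*} [Group Γ] (K I : Finset Γ) (ε : ℝ) (hε : 0 < ε) (hε1 : ε < 1)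
    (hK : K.Nonempty) :
    ∃ R ⊆ I, (1 - ε) * (R.card * K.card) ≤ (prd K R).card ∧
      ε * I.card ≤ (prd K R).card := by
  let S := I.powerset.filter fun R => (1 - ε) * ((R.card : ℝ) * K.card) ≤ (prd K R).card
  have hS : S.Nonempty := ⟨∅, by simp [S]⟩
  obtain ⟨R, hRS, hmax⟩ := Finset.exists_max_image S Finset.card hS
  simp only [S, Finset.mem_filter, Finset.mem_powerset] at hRS hmax
  refine ⟨R, hRS.1, hRS.2, ?_⟩
  have hKpos : (0 : ℝ) < K.card := by exact_mod_cast hK.card_pos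
  have key : ∀ g ∈ I, ε * K.card ≤ ((K.filter fun k => k * g ∈ prd K R).card : ℝ) := by
    intro g hg
    by_cases hgR : g ∈ R
    · have : K.filter (fun k => k * g ∈ prd K R) = K := by
        apply Finset.filter_true_of_mem
        intro k hk
        exact mem_prd.2 ⟨g, hgR, k, hk, rfl⟩
      rw [this]; nlinarith
    · by_contra hlt
      push Not at hlt
      have h1 : (prd K (insert g R)).card + (K.filter fun k => k * g ∈ prd K R).card
          = K.card + (prd K R).card := by
        have e : (K.filter fun k => k * g ∈ prd K R).card
            = ((K.image fun k => k * g) ∩ prd K R).card := by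
          rw [← Finset.card_image_of_injective _ (mul_left_injective g)]
          congr 1
          ext x
          simp only [Finset.mem_image, Finset.mem_filter, Finset.mem_inter]
          constructor
          · rintro ⟨k, ⟨hk, hk2⟩, rfl⟩; exact ⟨⟨k, hk, rfl⟩, hk2⟩
          · rintro ⟨⟨k, hk, rfl⟩, hk2⟩; exact ⟨k, ⟨hk, hk2⟩, rfl⟩
        rw [e, prd_insert, Finset.card_union_add_card_inter, card_trans]
      have h1' : ((prd K (insert g R)).card : ℝ) + (K.filter fun k => k * g ∈ prd K R).card
          = K.card + (prd K R).card := by exact_mod_cast h1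
      have := hmax (insert g R) ⟨Finset.insert_subset hg hRS.1, by
        rw [Finset.card_insert_of_notMem hgR]; push_cast; nlinarith [hRS.2]⟩
      rw [Finset.card_insert_of_notMem hgR] at this
      omega
  have hsum : ∑ g ∈ I, ((K.filter fun k => k * g ∈ prd K R).card : ℝ)
      ≤ K.card * (prd K R).card := by
    have : ∑ g ∈ I, (K.filter fun k => k * g ∈ prd K R).card
        = ∑ k ∈ K, (I.filter fun g => k * g ∈ prd K R).card := by
      simp only [Finset.card_filter]
      exact Finset.sum_comm
    have h2 : ∑ k ∈ K, (I.filter fun g => k * g ∈ prd K R).card ≤ ∑ k ∈ K, (prd K R).card := by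
      apply Finset.sum_le_sum
      intro k _
      apply Finset.card_le_card_of_injOn (fun g => k * g)
      · intro g hg; simpa using (Finset.mem_filter.1 hg).2
      · exact (mul_right_injective k).injOn
    rw [Finset.sum_const, smul_eq_mul, ← this] at h2
    exact_mod_cast h2
  have := Finset.sum_le_sum key
  rw [Finset.sum_const, nsmul_eq_mul] at this
  have h3 : (K.card : ℝ) * (ε * I.card) ≤ K.card * (prd K R).card := by nlinarith
  exact le_of_mul_le_mul_left h3 hKpos

open Classical in
lemma inv_sdiff {Γ : Type*} [Group Γ] (Ω K R : Finset Γ) (d : Γ) (a b : ℝ)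
    (h1 : ((Ω.filter fun w => d * w ∉ Ω).card : ℝ) ≤ a)
    (h2 : ((K.filter fun w => d⁻¹ * w ∉ K).card : ℝ) ≤ b) :
    (((Ω \ prd K R).filter fun w => d * w ∉ Ω \ prd K R).card : ℝ) ≤ a + R.card * b := by
  have hsub : ((Ω \ prd K R).filter fun w => d * w ∉ Ω \ prd K R) ⊆
      (Ω.filter fun w => d * w ∉ Ω) ∪
        R.biUnion fun r => (K.filter fun w => d⁻¹ * w ∉ K).image fun k => d⁻¹ * k * r := by
    intro w hw
    simp only [Finset.mem_filter, Finset.mem_sdiff, Finset.mem_union, Finset.mem_biUnion,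
      Finset.mem_image, not_and, not_not] at hw ⊢
    by_cases h : d * w ∈ Ω
    · right
      obtain ⟨r, hr, k, hk, hkr⟩ := mem_prd.1 (hw.2 h)
      have hw' : d⁻¹ * k * r = w := by rw [mul_assoc, hkr]; group
      exact ⟨r, hr, k, ⟨hk, fun hc => hw.1.2 (mem_prd.2 ⟨r, hr, _, hc, hw'⟩)⟩, hw'⟩
    · exact Or.inl ⟨hw.1.1, h⟩
  have hc := (Finset.card_le_card hsub).trans (Finset.card_union_le _ _)
  have hc2 : (R.biUnion fun r => (K.filter fun w => d⁻¹ * w ∉ K).image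
      fun k => d⁻¹ * k * r).card ≤ R.card * (K.filter fun w => d⁻¹ * w ∉ K).card :=
    Finset.card_biUnion_le_card_mul _ _ _ fun r _ => Finset.card_image_le
  have hc3 : (((Ω \ prd K R).filter fun w => d * w ∉ Ω \ prd K R).card : ℝ) ≤
      (Ω.filter fun w => d * w ∉ Ω).card + R.card * (K.filter fun w => d⁻¹ * w ∉ K).card := by
    exact_mod_cast hc.trans (Nat.add_le_add_left hc2 _)
  have : (R.card : ℝ) * (K.filter fun w => d⁻¹ * w ∉ K).card ≤ R.card * b := by gcongr
  linarith

open Classical in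
/-- Assumptions on the subadditive function. -/
structure SubAdd {Γ : Type*} [Group Γ] (h : Finset Γ → ℝ) : Prop where
  empty : h ∅ = 0
  nonneg : ∀ A, 0 ≤ h A
  union : ∀ A B, h (A ∪ B) ≤ h A + h B
  trans : ∀ A g, h (A.image fun a => a * g) ≤ h A

open Classical in
lemma SubAdd.prd_le {Γ : Type*} [Group Γ] {h : Finset Γ → ℝ} (H : SubAdd h) (K R : Finset Γ) :
    h (prd K R) ≤ R.card * h K := by
  induction R using Finset.induction_on with
  | empty => simp [prd, H.empty]
  | insert g R hg ih =>
    rw [prd_insert, Finset.card_insert_of_notMem hg]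
    have := H.union (K.image fun k => k * g) (prd K R)
    have := H.trans K g
    push_cast
    linarith

open Classical in
lemma SubAdd.le_card {Γ : Type*} [Group Γ] {h : Finset Γ → ℝ} (H : SubAdd h) (R : Finset Γ) :
    h R ≤ R.card * h {1} := by
  have := H.prd_le {1} R
  have e : prd {1} R = R := by ext; simp [mem_prd]
  rwa [e] at this

open Classical in
lemma tile {Γ : Type*} [Group Γ] {h : Finset Γ → ℝ} (H : SubAdd h) (lam ε : ℝ)
    (hε : 0 < ε) (hε2 : ε < 1 / 2) (hlam : 0 ≤ lam)
    (hfr : ∀ (D : Finset Γ) (δ : ℝ), 0 < δ → ∃ K : Finset Γ, K.Nonempty ∧ Inv D δ K ∧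
      h K ≤ lam * K.card) (k : ℕ) :
    ∃ (D : Finset Γ) (δ : ℝ), 0 < δ ∧ ∀ Ω : Finset Γ, Inv D δ Ω →
      ∃ A ⊆ Ω, (1 - ε) * h A ≤ lam * A.card ∧
        ((Ω \ A).card : ℝ) ≤ max ε ((1 - ε / 2) ^ k) * Ω.card := by
  induction k with
  | zero =>
    refine ⟨∅, 1, one_pos, fun Ω _ => ⟨∅, by simp, by simp [H.empty], ?_⟩⟩
    simp only [Finset.sdiff_empty, pow_zero]
    rw [max_eq_right (by linarith), one_mul]
  | succ k ih =>
    obtain ⟨D, δ, hδ, hD⟩ := ih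
    obtain ⟨K, hK, hKinv, hKh⟩ := hfr (D.image fun d => d⁻¹) (ε * δ / 4) (by positivity)
    have hKpos : (0 : ℝ) < K.card := by exact_mod_cast hK.card_pos
    refine ⟨D ∪ K, min (ε * δ / 2) (1 / (2 * K.card)), by positivity, fun Ω hΩ => ?_⟩
    let I := Ω.filter fun g => ∀ k ∈ K, k * g ∈ Ω
    have hI : (Ω.card : ℝ) / 2 ≤ I.card := by
      have hs : Ω \ I ⊆ K.biUnion fun k => Ω.filter fun w => k * w ∉ Ω := by
        intro w hw
        simp only [I, Finset.mem_sdiff, Finset.mem_filter, Finset.mem_biUnion] at hw ⊢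
        push Not at hw
        obtain ⟨k, hk, hk2⟩ := hw.2 hw.1
        exact ⟨k, hk, hw.1, hk2⟩
      have h1 : ((Ω \ I).card : ℝ) ≤ ∑ k ∈ K, ((Ω.filter fun w => k * w ∉ Ω).card : ℝ) := by
        exact_mod_cast (Finset.card_le_card hs).trans Finset.card_biUnion_le
      have h2 : ∑ k ∈ K, ((Ω.filter fun w => k * w ∉ Ω).card : ℝ)
          ≤ ∑ k ∈ K, (1 / (2 * K.card) * Ω.card : ℝ) := by
        apply Finset.sum_le_sum
        intro k hk
        refine (hΩ k (Finset.mem_union_right _ hk)).trans ?_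
        gcongr
        exact min_le_right _ _
      rw [Finset.sum_const, nsmul_eq_mul] at h2
      have h3 : (K.card : ℝ) * (1 / (2 * K.card) * Ω.card) = Ω.card / 2 := by
        field_simp
      have h4 : ((Ω \ I).card : ℝ) + I.card = Ω.card := by
        exact_mod_cast Finset.card_sdiff_add_card_eq_card (Finset.filter_subset _ _)
      linarith
    obtain ⟨R, hRI, hR1, hR2⟩ := filling K I ε hε (by linarith) hK
    have hsubΩ : prd K R ⊆ Ω := by
      intro x hx
      obtain ⟨r, hr, k, hk, rfl⟩ := mem_prd.1 hx
      exact (Finset.mem_filter.1 (hRI hr)).2 k hk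
    have hh : (1 - ε) * h (prd K R) ≤ lam * (prd K R).card := by
      have h1 := H.prd_le K R
      have h2 : (R.card : ℝ) * h K ≤ R.card * (lam * K.card) := by gcongr
      calc (1 - ε) * h (prd K R) ≤ (1 - ε) * (R.card * (lam * K.card)) := by
            apply mul_le_mul_of_nonneg_left (h1.trans h2); linarith
        _ = lam * ((1 - ε) * (R.card * K.card)) := by ring
        _ ≤ _ := by gcongr
    have hcard : ((Ω \ prd K R).card : ℝ) + (prd K R).card = Ω.card := by
      exact_mod_cast Finset.card_sdiff_add_card_eq_card hsubΩ
    by_cases hsmall : ((Ω \ prd K R).card : ℝ) ≤ ε * Ω.card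
    · refine ⟨prd K R, hsubΩ, hh, hsmall.trans ?_⟩
      gcongr
      exact le_max_left _ _
    · push Not at hsmall
      have hinv : Inv D δ (Ω \ prd K R) := by
        intro d hd
        have h1 := hΩ d (Finset.mem_union_left _ hd)
        have h2 := hKinv d⁻¹ (Finset.mem_image_of_mem _ hd)
        have h3 := inv_sdiff Ω K R d _ _ h1 h2
        refine h3.trans ?_
        have h4 : min (ε * δ / 2) (1 / (2 * (K.card : ℝ))) * Ω.card ≤ ε * δ / 2 * Ω.card := by
          gcongr; exact min_le_left _ _
        have h5 : (R.card : ℝ) * K.card ≤ 2 * Ω.card := by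
          have h7 : (0 : ℝ) ≤ R.card * K.card := by positivity
          have h8 : (0 : ℝ) ≤ (Ω \ prd K R).card := by positivity
          nlinarith
        have h6 : (R.card : ℝ) * (ε * δ / 4 * K.card) ≤ ε * δ / 4 * (2 * Ω.card) := by
          have : (0:ℝ) < ε * δ / 4 := by positivity
          nlinarith
        have h9 : δ * (ε * Ω.card) ≤ δ * (Ω \ prd K R).card := by gcongr
        nlinarith
      obtain ⟨A, hA, hAh, hAc⟩ := hD _ hinv
      refine ⟨prd K R ∪ A, Finset.union_subset hsubΩ (hA.trans Finset.sdiff_subset), ?_, ?_⟩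
      · have hdisj : Disjoint (prd K R) A :=
          Finset.disjoint_of_subset_right hA Finset.disjoint_sdiff
        rw [Finset.card_union_of_disjoint hdisj]
        push_cast
        have := mul_le_mul_of_nonneg_left (H.union (prd K R) A) (by linarith : 0 ≤ 1 - ε)
        linarith
      · have e : Ω \ (prd K R ∪ A) = (Ω \ prd K R) \ A := by
          ext; simp [and_assoc]
        rw [e]
        refine hAc.trans ?_
        have h1 : ((Ω \ prd K R).card : ℝ) ≤ (1 - ε / 2) * Ω.card := by nlinarith
        have hm : 0 ≤ max ε ((1 - ε / 2) ^ k) := hε.le.trans (le_max_left _ _)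
        refine (mul_le_mul_of_nonneg_left h1 hm).trans ?_
        rw [← mul_assoc]
        gcongr
        have hp : 0 ≤ 1 - ε / 2 := by linarith
        rw [max_mul_of_nonneg _ _ hp, pow_succ]
        apply max_le_max _ le_rfl
        nlinarith

open Classical in
lemma folner_inv {Γ : Type*} [Group Γ] {F : ℕ → Finset Γ} (hF : IsFolner Γ F)
    (D : Finset Γ) (δ : ℝ) (hδ : 0 < δ) : ∀ᶠ n in atTop, Inv D δ (F n) := by
  unfold Inv
  rw [Filter.eventually_all_finset]
  intro d _
  have := (hF.2 {d} (by simp)).eventually (gt_mem_nhds hδ)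
  filter_upwards [this] with n hn
  have hpos : (0 : ℝ) < (F n).card := by exact_mod_cast (hF.1 n).card_pos
  rw [div_lt_iff₀ hpos] at hn
  refine le_trans ?_ hn.le
  norm_cast
  apply Finset.card_le_card_of_injOn (fun w => d * w)
  · intro w hw
    have hw := Finset.mem_filter.1 (Finset.mem_coe.1 hw)
    refine Finset.mem_coe.2 (Finset.mem_symmDiff.2 (Or.inl ⟨?_, hw.2⟩))
    exact Finset.mem_biUnion.2 ⟨d, Finset.mem_singleton_self d,
      Finset.mem_image.2 ⟨w, hw.1, rfl⟩⟩
  · exact (mul_right_injective d).injOn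

/-- The Ornstein-Weiss lemma. -/
lemma ornstein_weiss {Γ : Type*} [Group Γ] {F : ℕ → Finset Γ} (hF : IsFolner Γ F)
    {h : Finset Γ → ℝ} (H : SubAdd h) :
    ∃ L : ℝ, Tendsto (fun n => h (F n) / (F n).card) atTop (𝓝 L) := by
  classical
  set u := fun n => h (F n) / ((F n).card : ℝ) with hu
  have hpos : ∀ n, (0 : ℝ) < (F n).card := fun n => by exact_mod_cast (hF.1 n).card_pos
  set M := h {1} with hM
  have hM0 : 0 ≤ M := H.nonneg _
  have hu0 : ∀ n, 0 ≤ u n := fun n => div_nonneg (H.nonneg _) (hpos n).le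
  have huM : ∀ n, u n ≤ M := fun n => by
    rw [hu]; simp only; rw [div_le_iff₀ (hpos n), mul_comm]; exact H.le_card _
  have hb1 : IsBoundedUnder (· ≥ ·) atTop u := isBoundedUnder_of ⟨0, hu0⟩
  have hb2 : IsBoundedUnder (· ≤ ·) atTop u := isBoundedUnder_of ⟨M, huM⟩
  set L := liminf u atTop with hL
  have hL0 : 0 ≤ L := le_liminf_of_le hb2.isCoboundedUnder_ge (Eventually.of_forall hu0)
  have key : ∀ ε : ℝ, 0 < ε → ε < 1 / 2 → limsup u atTop ≤ (L + ε) / (1 - ε) + ε * M := by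
    intro ε hε hε2
    have hfreq : ∃ᶠ n in atTop, u n < L + ε :=
      frequently_lt_of_liminf_lt hb2.isCoboundedUnder_ge (by linarith)
    have hfr : ∀ (D : Finset Γ) (δ : ℝ), 0 < δ → ∃ K : Finset Γ, K.Nonempty ∧ Inv D δ K ∧
        h K ≤ (L + ε) * K.card := by
      intro D δ hδ
      obtain ⟨n, hn1, hn2⟩ := (hfreq.and_eventually (folner_inv hF D δ hδ)).exists
      refine ⟨F n, hF.1 n, hn2, ?_⟩
      exact ((div_lt_iff₀ (hpos n)).1 hn1).le
    obtain ⟨k, hk⟩ := exists_pow_lt_of_lt_one hε (by linarith : 1 - ε / 2 < 1)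
    obtain ⟨D, δ, hδ, hD⟩ := tile H (L + ε) ε hε hε2 (by linarith) hfr k
    apply limsup_le_of_le hb1.isCoboundedUnder_le
    filter_upwards [folner_inv hF D δ hδ] with n hn
    obtain ⟨A, hA, hAh, hAc⟩ := hD _ hn
    rw [max_eq_left hk.le] at hAc
    have h1 := H.union A (F n \ A)
    rw [Finset.union_sdiff_of_subset hA] at h1
    have h2 := H.le_card (F n \ A)
    have h3 : ((F n \ A).card : ℝ) * M ≤ ε * (F n).card * M := by gcongr
    have h4 : (A.card : ℝ) ≤ (F n).card := by exact_mod_cast Finset.card_le_card hA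
    have h5 : h A ≤ (L + ε) / (1 - ε) * (F n).card := by
      rw [div_mul_eq_mul_div, le_div_iff₀ (by linarith), mul_comm (h A)]
      refine hAh.trans ?_
      gcongr
    rw [hu]; simp only
    rw [div_le_iff₀ (hpos n)]
    nlinarith
  refine ⟨L, tendsto_of_le_liminf_of_limsup_le le_rfl ?_ hb2 hb1⟩
  have ht : Tendsto (fun ε : ℝ => (L + ε) / (1 - ε) + ε * M) (𝓝[>] 0) (𝓝 L) := by
    have : ContinuousAt (fun ε : ℝ => (L + ε) / (1 - ε) + ε * M) 0 := by
      apply ContinuousAt.add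
      · apply ContinuousAt.div (by fun_prop) (by fun_prop); norm_num
      · fun_prop
    have h2 := this.tendsto
    simp only [add_zero, sub_zero, div_one, zero_mul] at h2
    exact h2.mono_left nhdsWithin_le_nhds
  refine ge_of_tendsto ht ?_
  filter_upwards [Ioo_mem_nhdsGT (by norm_num : (0:ℝ) < 1 / 2)] with ε hε
  exact key ε hε.1 hε.2

end OWAux

namespace OWAux

variable {Γ X : Type*} [Group Γ]

/-- `c` is a family of words covering `X`. -/
def IsCov [MulAction Γ X] (U : Finset (Set X)) (E : Finset Γ) (c : Finset (Γ → Set X)) : Prop :=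
  (∀ f ∈ c, ∀ s : Γ, f s ∈ U) ∧ ∀ x : X, ∃ f ∈ c, ∀ s ∈ E, s • x ∈ f s

lemma cov_aux [MulAction Γ X] (U : Finset (Set X)) (E : Finset Γ) (c : Finset (Γ → Set X)) :
    ((∀ f ∈ c, ∀ s : Γ, f s ∈ U) ∧
      (Set.univ : Set X) ⊆ ⋃ f ∈ c, ⋂ s ∈ E, (fun x : X => s • x) ⁻¹' f s) ↔ IsCov U E c := by
  simp [IsCov, Set.subset_def]

lemma covNum_le [TopologicalSpace X] [MulAction Γ X] {U : Finset (Set X)} {E : Finset Γ}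
    {c : Finset (Γ → Set X)} (h : IsCov U E c) : covNumOn Γ X Set.univ U E ≤ c.card :=
  Nat.sInf_le ⟨c, rfl, (cov_aux U E c).2 h⟩

lemma covNum_exists [TopologicalSpace X] [MulAction Γ X] {U : Finset (Set X)} {E : Finset Γ}
    {c : Finset (Γ → Set X)} (h : IsCov U E c) :
    ∃ c', IsCov U E c' ∧ c'.card = covNumOn Γ X Set.univ U E := by
  obtain ⟨c', h1, h2⟩ := Nat.sInf_mem (s := {n : ℕ | ∃ c : Finset (Γ → Set X), c.card = n ∧
    (∀ f ∈ c, ∀ s : Γ, f s ∈ U) ∧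
    Set.univ ⊆ ⋃ f ∈ c, ⋂ s ∈ E, (fun x : X => s • x) ⁻¹' f s}) ⟨_, c, rfl, (cov_aux U E c).2 h⟩
  exact ⟨c', (cov_aux U E c').1 h2, h1⟩

open Classical in
lemma isCov_union [MulAction Γ X] {U : Finset (Set X)} {A B : Finset Γ}
    {c d : Finset (Γ → Set X)} (hc : IsCov U A c) (hd : IsCov U B d) :
    IsCov U (A ∪ B) ((c ×ˢ d).image fun p s => if s ∈ A then p.1 s else p.2 s) := by
  constructor
  · intro f hf s
    obtain ⟨p, hp, rfl⟩ := Finset.mem_image.1 hf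
    have hp := Finset.mem_product.1 hp
    simp only
    split_ifs
    · exact hc.1 _ hp.1 s
    · exact hd.1 _ hp.2 s
  · intro x
    obtain ⟨f, hf, hfx⟩ := hc.2 x
    obtain ⟨g, hg, hgx⟩ := hd.2 x
    refine ⟨_, Finset.mem_image_of_mem _ (Finset.mk_mem_product hf hg), ?_⟩
    intro s hs
    simp only
    split_ifs with h
    · exact hfx s h
    · exact hgx s ((Finset.mem_union.1 hs).resolve_left h)

open Classical in
lemma isCov_trans [MulAction Γ X] {U : Finset (Set X)} {A : Finset Γ}
    {c : Finset (Γ → Set X)} (hc : IsCov U A c) (g : Γ) :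
    IsCov U (A.image fun a => a * g) (c.image fun f s => f (s * g⁻¹)) := by
  constructor
  · intro f hf s
    obtain ⟨p, hp, rfl⟩ := Finset.mem_image.1 hf
    exact hc.1 _ hp _
  · intro x
    obtain ⟨f, hf, hfx⟩ := hc.2 (g • x)
    refine ⟨_, Finset.mem_image_of_mem _ hf, ?_⟩
    intro s hs
    obtain ⟨a, ha, rfl⟩ := Finset.mem_image.1 hs
    simpa [mul_smul] using hfx a ha

open Classical in
lemma isCov_exists [MulAction Γ X] {U : Finset (Set X)} (hU : ∀ x : X, ∃ V ∈ U, x ∈ V)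
    (E : Finset Γ) : ∃ c : Finset (Γ → Set X), IsCov U E c := by
  rcases isEmpty_or_nonempty X with hX | ⟨⟨x0⟩⟩
  · exact ⟨∅, by simp [IsCov]⟩
  induction E using Finset.induction_on with
  | empty =>
    obtain ⟨V, hV, _⟩ := hU x0
    exact ⟨{fun _ => V}, by simpa [IsCov] using hV⟩
  | insert a E ha ih =>
    obtain ⟨c, hc⟩ := ih
    have h1 : IsCov U {a} (U.image fun V (_ : Γ) => V) := by
      constructor
      · intro f hf s
        obtain ⟨p, hp, rfl⟩ := Finset.mem_image.1 hf
        exact hp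
      · intro x
        obtain ⟨V, hV, hx⟩ := hU (a • x)
        refine ⟨_, Finset.mem_image_of_mem _ hV, ?_⟩
        simpa using hx
    exact ⟨_, by rw [Finset.insert_eq]; exact isCov_union h1 hc⟩

lemma log_le_of_le_mul {a b c : ℕ} (h : a ≤ b * c) :
    Real.log a ≤ Real.log b + Real.log c := by
  rcases Nat.eq_zero_or_pos a with rfl | ha
  · simpa using add_nonneg (Real.log_natCast_nonneg b) (Real.log_natCast_nonneg c)
  · have hbc : b * c ≠ 0 := by omega
    have hb : (b : ℝ) ≠ 0 := by exact_mod_cast left_ne_zero_of_mul hbc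
    have hc : (c : ℝ) ≠ 0 := by exact_mod_cast right_ne_zero_of_mul hbc
    rw [← Real.log_mul hb hc]
    apply Real.log_le_log (by exact_mod_cast ha)
    exact_mod_cast h

lemma log_le_of_le {a b : ℕ} (h : a ≤ b) : Real.log a ≤ Real.log b := by
  have := log_le_of_le_mul (a := a) (b := b) (c := 1) (by simpa using h)
  simpa using this

lemma subAdd_cov [TopologicalSpace X] [MulAction Γ X] {U : Finset (Set X)}
    (hU : ∀ x : X, ∃ V ∈ U, x ∈ V) :
    SubAdd fun E : Finset Γ => Real.log (covNumOn Γ X Set.univ U E) where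
  empty := by
    have : covNumOn Γ X Set.univ U ∅ ≤ 1 := by
      rcases isEmpty_or_nonempty X with hX | ⟨⟨x0⟩⟩
      · refine (covNum_le (c := ∅) (by simp [IsCov])).trans (by simp)
      · obtain ⟨V, hV, _⟩ := hU x0
        exact covNum_le (c := {fun _ => V}) (by simpa [IsCov] using hV)
    interval_cases h : covNumOn Γ X Set.univ U ∅ <;> simp
  nonneg A := Real.log_natCast_nonneg _
  union A B := by
    classical
    obtain ⟨c, hc⟩ := isCov_exists hU A
    obtain ⟨d, hd⟩ := isCov_exists hU B
    obtain ⟨c, hc, hcn⟩ := covNum_exists hc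
    obtain ⟨d, hd, hdn⟩ := covNum_exists hd
    apply log_le_of_le_mul
    rw [← hcn, ← hdn, ← Finset.card_product]
    convert (covNum_le (isCov_union hc hd)).trans Finset.card_image_le
  trans A g := by
    classical
    obtain ⟨c, hc⟩ := isCov_exists hU A
    obtain ⟨c, hc, hcn⟩ := covNum_exists hc
    apply log_le_of_le
    rw [← hcn]
    convert (covNum_le (isCov_trans hc g)).trans Finset.card_image_le

/-- Small covers. -/
lemma small_cover [MetricSpace X] [CompactSpace X] {ε : ℝ} (hε : 0 < ε) :
    ∃ U : Finset (Set X), (∀ V ∈ U, IsOpen V) ∧ (∀ x : X, ∃ V ∈ U, x ∈ V) ∧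
      ∀ V ∈ U, ∀ x ∈ V, ∀ y ∈ V, dist x y < ε := by
  classical
  obtain ⟨t, ht⟩ := isCompact_univ.elim_finite_subcover (fun x : X => Metric.ball x (ε / 2))
    (fun x => Metric.isOpen_ball)
    (fun x _ => Set.mem_iUnion.2 ⟨x, Metric.mem_ball_self (by positivity)⟩)
  refine ⟨t.image fun x => Metric.ball x (ε / 2), ?_, ?_, ?_⟩
  · intro V hV
    obtain ⟨x, _, rfl⟩ := Finset.mem_image.1 hV
    exact Metric.isOpen_ball
  · intro x
    obtain ⟨y, hy, hxy⟩ := Set.mem_iUnion₂.1 (ht (Set.mem_univ x))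
    exact ⟨_, Finset.mem_image_of_mem _ hy, hxy⟩
  · intro V hV x hx y hy
    obtain ⟨z, _, rfl⟩ := Finset.mem_image.1 hV
    have h1 := Metric.mem_ball.1 hx
    have h2 := Metric.mem_ball'.1 hy
    linarith [dist_triangle x z y]

lemma sep_card_le [MetricSpace X] [MulAction Γ X] {U : Finset (Set X)} {ε : ℝ}
    (hU : ∀ x : X, ∃ V ∈ U, x ∈ V) (hd : ∀ V ∈ U, ∀ x ∈ V, ∀ y ∈ V, dist x y < ε)
    (E : Finset Γ) (W : Finset X)
    (hW : ∀ x ∈ W, ∀ y ∈ W, x ≠ y → ∃ s ∈ E, ε ≤ dist (s • x) (s • y)) :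
    W.card ≤ covNumOn Γ X Set.univ U E := by
  obtain ⟨c, hc⟩ := isCov_exists hU E
  obtain ⟨c, hc, hcn⟩ := covNum_exists hc
  rw [← hcn]
  choose f hf hfx using hc.2
  apply Finset.card_le_card_of_injOn f (fun x _ => hf x)
  intro x hx y hy hxy
  by_contra hne
  obtain ⟨s, hs, hle⟩ := hW x hx y hy hne
  have h1 := hfx x s hs
  have h2 := hfx y s hs
  rw [← hxy] at h2
  exact absurd (hd _ (hc.1 _ (hf x) s) _ h1 _ h2) (not_lt.2 hle)

/-- Comparison of separated, spanning and covering numbers. -/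
lemma spn_sep_cov [MetricSpace X] [MulAction Γ X] {U : Finset (Set X)} {ε : ℝ}
    (hU : ∀ x : X, ∃ V ∈ U, x ∈ V) (hd : ∀ V ∈ U, ∀ x ∈ V, ∀ y ∈ V, dist x y < ε)
    (hε : 0 < ε) (E : Finset Γ) :
    (∃ W : Finset X, W.card = spnNum Γ X Set.univ E ε ∧
      ∀ x : X, ∃ w ∈ W, ∀ s ∈ E, dist (s • x) (s • w) < ε) ∧
    spnNum Γ X Set.univ E ε ≤ sepNum Γ X Set.univ E ε ∧
    sepNum Γ X Set.univ E ε ≤ covNumOn Γ X Set.univ U E := by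
  classical
  let S := {n : ℕ | ∃ W : Finset X, (↑W : Set X) ⊆ Set.univ ∧ W.card = n ∧
    ∀ x ∈ W, ∀ y ∈ W, x ≠ y → ∃ s ∈ E, ε ≤ dist (s • x) (s • y)}
  have hS0 : S.Nonempty := ⟨0, ∅, by simp⟩
  have hSb : ∀ n ∈ S, n ≤ covNumOn Γ X Set.univ U E := by
    rintro n ⟨W, _, rfl, hW⟩
    exact sep_card_le hU hd E W hW
  have hbdd : BddAbove S := ⟨_, hSb⟩
  obtain ⟨W, _, hWc, hW⟩ := Nat.sSup_mem hS0 hbdd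
  have hspan : ∀ x : X, ∃ w ∈ W, ∀ s ∈ E, dist (s • x) (s • w) < ε := by
    intro x
    by_contra hcon
    push Not at hcon
    have hxW : x ∉ W := by
      intro hx
      obtain ⟨s, _, hs⟩ := hcon x hx
      rw [dist_self] at hs
      linarith
    have : W.card + 1 ∈ S := by
      refine ⟨insert x W, Set.subset_univ _, Finset.card_insert_of_notMem hxW, ?_⟩
      intro a ha b hb hab
      rcases Finset.mem_insert.1 ha with rfl | ha2 <;> rcases Finset.mem_insert.1 hb with rfl | hb2
      · exact absurd rfl hab
      · exact hcon b hb2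
      · obtain ⟨s, hs, h⟩ := hcon a ha2
        exact ⟨s, hs, by rwa [dist_comm]⟩
      · exact hW a ha2 b hb2 hab
    have := le_csSup hbdd this
    omega
  have hmem : sepNum Γ X Set.univ E ε ∈ {n : ℕ | ∃ W : Finset X, (↑W : Set X) ⊆ Set.univ ∧
      W.card = n ∧ ∀ x ∈ (Set.univ : Set X), ∃ w ∈ W, ∀ s ∈ E, dist (s • x) (s • w) < ε} :=
    ⟨W, Set.subset_univ _, hWc, fun x _ => hspan x⟩
  refine ⟨?_, Nat.sInf_le hmem, csSup_le hS0 hSb⟩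
  obtain ⟨W', _, h1, h2⟩ := Nat.sInf_mem ⟨_, hmem⟩
  exact ⟨W', h1, fun x => h2 x (Set.mem_univ x)⟩

lemma expansive_unif [MetricSpace X] [CompactSpace X] [MulAction Γ X] (hact : ContAction Γ X)
    {κ : ℝ} (hexp : ∀ x y : X, x ≠ y → ∃ s : Γ, κ < dist (s • x) (s • y))
    {δ : ℝ} (hδ : 0 < δ) :
    ∃ K : Finset Γ, K.Nonempty ∧
      ∀ x y : X, (∀ k ∈ K, dist (k • x) (k • y) ≤ κ) → dist x y < δ := by
  classical
  have hcl : IsClosed {p : X × X | δ ≤ dist p.1 p.2} :=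
    isClosed_le continuous_const (continuous_fst.dist continuous_snd)
  obtain ⟨t, ht⟩ := hcl.isCompact.elim_finite_subcover
    (fun s : Γ => {p : X × X | κ < dist (s • p.1) (s • p.2)})
    (fun s => isOpen_lt continuous_const
      (((hact s).comp continuous_fst).dist ((hact s).comp continuous_snd)))
    (by
      rintro ⟨x, y⟩ hp
      have hne : x ≠ y := by
        rintro rfl
        have : δ ≤ dist x x := hp
        rw [dist_self] at this
        linarith
      exact Set.mem_iUnion.2 (hexp x y hne))
  refine ⟨insert 1 t, Finset.insert_nonempty _ _, fun x y h => ?_⟩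
  by_contra hcon
  push Not at hcon
  have hm : (x, y) ∈ {p : X × X | δ ≤ dist p.1 p.2} := hcon
  obtain ⟨s, hs, h2⟩ := Set.mem_iUnion₂.1 (ht hm)
  have h2 : κ < dist (s • x) (s • y) := h2
  linarith [h s (Finset.mem_insert_of_mem hs)]

open Classical in
/-- The key counting lemma. -/
lemma cov_le_spn [MetricSpace X] [MulAction Γ X]
    {κ ε δ : ℝ} (hε : 0 < ε) (hεκ : ε < κ / 4) {K : Finset Γ}
    (hK : ∀ x y : X, (∀ k ∈ K, dist (k • x) (k • y) ≤ κ) → dist x y < δ)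
    {U Q : Finset (Set X)} (hU : ∀ x : X, ∃ V ∈ U, Metric.ball x δ ⊆ V)
    (hQ : ∀ x : X, ∃ V ∈ Q, x ∈ V) (hd : ∀ V ∈ Q, ∀ x ∈ V, ∀ y ∈ V, dist x y < ε)
    (E T : Finset Γ) (hT : ∀ k ∈ K, ∀ s ∈ E, k * s ∈ E ∪ T) :
    covNumOn Γ X Set.univ U E ≤ spnNum Γ X Set.univ E ε * Q.card ^ T.card := by
  rcases isEmpty_or_nonempty X with hX | hX
  · refine (covNum_le (c := ∅) (by simp [IsCov])).trans (by simp)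
  obtain ⟨⟨W, hWc, hW⟩, -, -⟩ := spn_sep_cov hQ hd hε E
  choose w hw hws using hW
  choose V hV hxV using hQ
  choose B hB hxB using hU
  let φ : X → W × (T → Q) := fun x => (⟨w x, hw x⟩, fun s => ⟨V (s.1 • x), hV _⟩)
  let c : Finset (Γ → Set X) :=
    Finset.univ.image fun a => fun s : Γ => B (s • Function.invFun φ a)
  have hc : IsCov U E c := by
    constructor
    · intro f hf s
      obtain ⟨a, _, rfl⟩ := Finset.mem_image.1 hf
      exact hB _
    · intro x
      refine ⟨_, Finset.mem_image_of_mem _ (Finset.mem_univ (φ x)), ?_⟩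
      intro s hs
      set z := Function.invFun φ (φ x) with hz
      have hφ : φ z = φ x := Function.invFun_eq ⟨x, rfl⟩
      have hwz : w z = w x := congrArg (fun p => (p.1 : X)) hφ
      have hVz : ∀ t ∈ T, V (t • z) = V (t • x) := fun t ht =>
        congrArg (fun p => ((p.2 ⟨t, ht⟩ : Q) : Set X)) hφ
      apply hxB
      rw [Metric.mem_ball]
      apply hK
      intro k hk
      rw [← mul_smul, ← mul_smul]
      rcases Finset.mem_union.1 (hT k hk s hs) with h | h
      · have h1 := hws x _ h
        have h2 := hws z _ h
        rw [hwz] at h2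
        have := dist_triangle_right ((k * s) • x) ((k * s) • z) ((k * s) • w x)
        linarith
      · have h1 := hxV ((k * s) • x)
        have h2 := hxV ((k * s) • z)
        rw [hVz _ h] at h2
        have := hd _ (hV _) _ h1 _ h2
        linarith
  refine (covNum_le hc).trans (Finset.card_image_le.trans ?_)
  rw [Finset.card_univ, Fintype.card_prod, Fintype.card_fun]
  simp [hWc]

lemma upper_bound [MetricSpace X] [CompactSpace X] [MulAction Γ X]
    (hact : ContAction Γ X) (F : ℕ → Finset Γ) (hF : IsFolner Γ F)
    {κ : ℝ} (hexp : ∀ x y : X, x ≠ y → ∃ s : Γ, κ < dist (s • x) (s • y))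
    {ε : ℝ} (hε0 : 0 < ε) (hεκ : ε < κ / 4)
    (U : Finset (Set X)) (hUo : ∀ V ∈ U, IsOpen V) (hU : ∀ x : X, ∃ V ∈ U, x ∈ V) :
    ∃ e : ℕ → ℝ, Tendsto e atTop (𝓝 0) ∧
      ∀ n, Real.log (covNumOn Γ X Set.univ U (F n)) / (F n).card ≤
        Real.log (spnNum Γ X Set.univ (F n) ε) / (F n).card + e n := by
  classical
  obtain ⟨Q, -, hQ, hd⟩ := small_cover (X := X) hε0
  obtain ⟨δ, hδ, hδU⟩ := lebesgue_number_lemma_of_metric_sUnion (s := (Set.univ : Set X))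
    (c := (↑U : Set (Set X))) isCompact_univ hUo
    (fun x _ => by obtain ⟨V, hV, hx⟩ := hU x; exact ⟨V, hV, hx⟩)
  obtain ⟨K, hK0, hK⟩ := expansive_unif hact hexp hδ
  have hlim := (hF.2 K hK0).mul_const (Real.log Q.card)
  rw [zero_mul] at hlim
  refine ⟨_, hlim, fun n => ?_⟩
  have hpos : (0 : ℝ) < (F n).card := by exact_mod_cast (hF.1 n).card_pos
  have h1 := cov_le_spn hε0 hεκ hK (fun x => hδU x (Set.mem_univ x)) hQ hd (F n)
    ((K.biUnion fun k => (F n).image fun t => k * t) ∆ (F n)) (by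
      intro k hk s hs
      by_cases h : k * s ∈ F n
      · exact Finset.mem_union_left _ h
      · refine Finset.mem_union_right _ (Finset.mem_symmDiff.2 (Or.inl ⟨?_, h⟩))
        exact Finset.mem_biUnion.2 ⟨k, hk, Finset.mem_image_of_mem _ hs⟩)
  have h2 := log_le_of_le_mul h1
  rw [Nat.cast_pow, Real.log_pow] at h2
  rw [div_mul_eq_mul_div, ← add_div]
  convert div_le_div_of_nonneg_right h2 hpos.le

end OWAux

/-- for expansive actions, topological entropy is computed by
separated and spanning numbers at any scale `ε < κ/4`. -/
theorem entropy_via_sep_spn {Γ X : Type*} [Group Γ] [Countable Γ]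
    [MetricSpace X] [CompactSpace X] [MulAction Γ X]
    (hact : ContAction Γ X)
    (F : ℕ → Finset Γ) (hF : IsFolner Γ F)
    (κ : ℝ) (hκ : 0 < κ)
    (hexp : ∀ x y : X, x ≠ y → ∃ s : Γ, κ < dist (s • x) (s • y))
    (ε : ℝ) (hε0 : 0 < ε) (hεκ : ε < κ / 4) :
    Tendsto (fun n => ((Real.log (sepNum Γ X Set.univ (F n) ε) / (F n).card : ℝ) : EReal))
      atTop (𝓝 (topEntOn Γ X Set.univ F)) ∧
    Tendsto (fun n => ((Real.log (spnNum Γ X Set.univ (F n) ε) / (F n).card : ℝ) : EReal))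
      atTop (𝓝 (topEntOn Γ X Set.univ F)) := by
  obtain ⟨U, hUo, hU, hd⟩ := OWAux.small_cover (X := X) hε0
  obtain ⟨L, hL⟩ := OWAux.ornstein_weiss hF (OWAux.subAdd_cov (Γ := Γ) hU)
  have hpos : ∀ n, (0 : ℝ) < (F n).card := fun n => by exact_mod_cast (hF.1 n).card_pos
  have hcmp := fun n => (OWAux.spn_sep_cov hU hd hε0 (F n)).2
  have h12 : ∀ n, Real.log (spnNum Γ X Set.univ (F n) ε) / (F n).card ≤
      Real.log (sepNum Γ X Set.univ (F n) ε) / (F n).card := fun n =>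
    div_le_div_of_nonneg_right (OWAux.log_le_of_le (hcmp n).1) (hpos n).le
  have h23 : ∀ n, Real.log (sepNum Γ X Set.univ (F n) ε) / (F n).card ≤
      Real.log (covNumOn Γ X Set.univ U (F n)) / (F n).card := fun n =>
    div_le_div_of_nonneg_right (OWAux.log_le_of_le (hcmp n).2) (hpos n).le
  have hspn : Tendsto (fun n => Real.log (spnNum Γ X Set.univ (F n) ε) / (F n).card)
      atTop (𝓝 L) := by
    obtain ⟨e, he, hle⟩ := OWAux.upper_bound hact F hF hexp hε0 hεκ U hUo hU
    have hlow := hL.sub he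
    rw [sub_zero] at hlow
    exact tendsto_of_tendsto_of_tendsto_of_le_of_le hlow hL
      (fun n => by have := hle n; simp only; linarith) (fun n => (h12 n).trans (h23 n))
  have hsep : Tendsto (fun n => Real.log (sepNum Γ X Set.univ (F n) ε) / (F n).card)
      atTop (𝓝 L) :=
    tendsto_of_tendsto_of_tendsto_of_le_of_le hspn hL h12 h23
  have htop : topEntOn Γ X Set.univ F = (L : EReal) := by
    unfold topEntOn
    apply le_antisymm
    · refine iSup₂_le fun U' hU' => ?_
      obtain ⟨e, he, hle⟩ := OWAux.upper_bound hact F hF hexp hε0 hεκ U' hU'.1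
        (fun x => by
          obtain ⟨V, hV, hx⟩ := hU'.2 (Set.mem_univ x)
          exact ⟨V, hV, hx⟩)
      have hup := hspn.add he
      rw [add_zero] at hup
      have hup' := (continuous_coe_real_ereal.tendsto L).comp hup
      rw [← hup'.limsup_eq]
      refine limsup_le_limsup (Eventually.of_forall fun n => ?_)
      exact EReal.coe_le_coe_iff.2 (hle n)
    · have hL' := (continuous_coe_real_ereal.tendsto L).comp hL
      rw [← hL'.limsup_eq]
      exact le_iSup₂_of_le U ⟨hUo, fun x _ => by
        obtain ⟨V, hV, hx⟩ := hU x
        exact ⟨V, hV, hx⟩⟩ le_rfl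
  rw [htop]
  exact ⟨(continuous_coe_real_ereal.tendsto L).comp hsep,
    (continuous_coe_real_ereal.tendsto L).comp hspn⟩
end
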